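/- arXiv:2306.01994 — 2 statements merged into one kernel-verified Lean document; each statement's English description precedes it below -/
import Mathlib

section
/- Let (Γ, x_0) be a perfect rooted tree of height h ≥ 1 and t = h + 1. Then reg(R/I_t(Γ)) = 1 + Σ_{x : 0 ≤ ℓ(x) ≤ h−2} deg⁺(x), where the sum runs over vertices x of Γ at levels 0 through h−2 and deg⁺(x) is the outdegree of x. -/
open MvPolynomial

structure MinFreeRes (k σ : Type) [Field k] (I : Ideal (MvPolynomial σ k)) where
  b : ℕ → ℕ
  deg : (i : ℕ) → Fin (b i) → ℕ
  d : (i : ℕ) → ((Fin (b (i + 1)) → MvPolynomial σ k) →ₗ[MvPolynomial σ k]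
        (Fin (b i) → MvPolynomial σ k))
  aug : (Fin (b 0) → MvPolynomial σ k) →ₗ[MvPolynomial σ k] (MvPolynomial σ k ⧸ I)
  aug_surjective : Function.Surjective aug
  exact_zero : Function.Exact (d 0) aug
  exact_succ : ∀ i : ℕ, Function.Exact (d (i + 1)) (d i)
  aug_homog : ∀ j : Fin (b 0), ∃ p : MvPolynomial σ k,
      p.IsHomogeneous (deg 0 j) ∧ aug (Pi.single j 1) = Ideal.Quotient.mk I p
  d_homog : ∀ (i : ℕ) (j : Fin (b (i + 1))) (l : Fin (b i)),
      (d i (Pi.single j 1) l).IsHomogeneous (deg (i + 1) j - deg i l) ∧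
        (deg (i + 1) j < deg i l → d i (Pi.single j 1) l = 0)
  minimal : ∀ (i : ℕ) (j : Fin (b (i + 1))) (l : Fin (b i)),
      MvPolynomial.constantCoeff (d i (Pi.single j 1) l) = 0

/-- The Castelnuovo-Mumford regularity of the module `R/I`, defined as the supremum of
`j - i` over the nonzero graded Betti numbers `β_{i,j}(R/I)`, read off from (any)
minimal graded free resolution of `R/I`. -/
noncomputable def reg (k σ : Type) [Field k] (I : Ideal (MvPolynomial σ k)) : ℤ :=
  sSup {x : ℤ | ∃ F : MinFreeRes k σ I, ∃ i : ℕ, ∃ j : Fin (F.b i), x = (F.deg i j : ℤ) - i}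

/-- A rooted tree on the vertex set `V`, encoded by the parent function (every edge is
directed away from the root). -/
structure RTree (V : Type) where
  root : V
  parent : V → V
  parent_root : parent root = root
  reach : ∀ v : V, ∃ n : ℕ, parent^[n] v = root

namespace RTree

variable {V : Type} [Fintype V] [DecidableEq V]

/-- The level of a vertex: its distance from the root. -/
noncomputable def level (T : RTree V) (v : V) : ℕ := Nat.find (T.reach v)

/-- The height of the rooted tree: the maximal level of a vertex. -/
noncomputable def height (T : RTree V) : ℕ := Finset.univ.sup fun v => T.level v

/-- The outdegree of a vertex: its number of children. -/
noncomputable def outdeg (T : RTree V) (x : V) : ℕ :=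
  Nat.card {y : V // T.parent y = x ∧ y ≠ T.root}

/-- A leaf is a vertex with no children. -/
def IsLeaf (T : RTree V) (x : V) : Prop := ∀ y : V, T.parent y = x → y = T.root

/-- A rooted tree is perfect if every leaf has level equal to the height. -/
def Perfect (T : RTree V) : Prop := ∀ x : V, T.IsLeaf x → T.level x = T.height

/-- The monomial of the directed path on `t` vertices ending at `v`
(valid when `level v ≥ t - 1`). -/
noncomputable def pathMonomial (T : RTree V) (k : Type) [Field k] (t : ℕ) (v : V) :
    MvPolynomial V k := ∏ j ∈ Finset.range t, MvPolynomial.X (T.parent^[j] v)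

/-- The `t`-path ideal `I_t(Γ)`: generated by the monomials of directed paths on
`t` vertices. -/
noncomputable def pathIdeal (T : RTree V) (k : Type) [Field k] (t : ℕ) :
    Ideal (MvPolynomial V k) :=
  Ideal.span {m | ∃ v : V, t ≤ T.level v + 1 ∧ m = T.pathMonomial k t v}

end RTree

namespace TaylorRes

set_option linter.unusedSectionVars false

open Finset

section Sign

variable {N : ℕ}

/-- The sign of `s` relative to `S`. -/
def sgn (s : Fin N) (S : Finset (Fin N)) : ℤ := ∏ r ∈ S, if r < s then -1 else 1

theorem sgn_sq (s : Fin N) (S : Finset (Fin N)) : sgn s S * sgn s S = 1 := by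
  unfold sgn
  rw [← Finset.prod_mul_distrib]
  apply Finset.prod_eq_one
  intro r _
  split_ifs <;> norm_num

theorem sgn_insert {r : Fin N} {S : Finset (Fin N)} (hr : r ∉ S) (s : Fin N) :
    sgn s (insert r S) = (if r < s then -1 else 1) * sgn s S := by
  unfold sgn
  rw [Finset.prod_insert hr]

theorem sgn_insert_self {s : Fin N} {S : Finset (Fin N)} (hr : s ∉ S) :
    sgn s (insert s S) = sgn s S := by
  rw [sgn_insert hr]; simp

theorem sgn_swap {s r : Fin N} {S : Finset (Fin N)} (hs : s ∉ S) (hr : r ∉ S) (hsr : s ≠ r) :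
    sgn s S * sgn r (insert s S) = - (sgn r S * sgn s (insert r S)) := by
  rw [sgn_insert hs, sgn_insert hr]
  rcases lt_or_gt_of_ne hsr with h | h
  · simp [h, h.not_gt]; ring
  · simp [h, h.not_gt]; ring

/-- The simplicial boundary. -/
def bd {M : Type*} [AddCommGroup M] (w : Finset (Fin N) → M) (S : Finset (Fin N)) : M :=
  ∑ s ∈ Sᶜ, sgn s S • w (insert s S)

theorem bd_bd {M : Type*} [AddCommGroup M] (w : Finset (Fin N) → M) (S : Finset (Fin N)) :
    bd (bd w) S = 0 := by
  unfold bd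
  simp_rw [Finset.smul_sum]
  rw [Finset.sum_sigma' Sᶜ (fun s => (insert s S)ᶜ)]
  refine Finset.sum_involution (fun x _ => ⟨x.2, x.1⟩) ?_ ?_ ?_ ?_
  · rintro ⟨s, r⟩ h
    simp only [mem_sigma, mem_compl, mem_insert, not_or] at h
    obtain ⟨hs, hrs, hr⟩ := h
    simp only [smul_smul]
    rw [sgn_swap hs hr (Ne.symm hrs), Finset.insert_comm s r S]
    simp
  · rintro ⟨s, r⟩ h _ heq
    simp only [mem_sigma, mem_compl, mem_insert, not_or] at h
    simp only [Sigma.mk.injEq] at heq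
    exact h.2.1 heq.1
  · rintro ⟨s, r⟩ h
    simp only [mem_sigma, mem_compl, mem_insert, not_or] at h ⊢
    exact ⟨h.2.2, Ne.symm h.2.1, h.1⟩
  · rintro ⟨s, r⟩ h
    rfl

/-- Cone contraction. -/
theorem bd_cone {M : Type*} [AddCommGroup M] (w v : Finset (Fin N) → M) (s0 : Fin N)
    (hw : ∀ S, bd w S = 0)
    (hv : ∀ S, v S = if s0 ∈ S then sgn s0 S • w (S.erase s0) else 0) (S : Finset (Fin N)) :
    bd v S = w S := by
  by_cases h0 : s0 ∈ S
  · obtain ⟨A, hA, rfl⟩ : ∃ A, s0 ∉ A ∧ insert s0 A = S :=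
      ⟨S.erase s0, by simp, Finset.insert_erase h0⟩
    have h1 := hw A
    unfold bd at h1 ⊢
    have hc : Aᶜ = insert s0 (insert s0 A)ᶜ := by
      ext x; by_cases hx : x = s0 <;> simp [hx, hA]
    rw [hc, Finset.sum_insert (by simp)] at h1
    have h2 : ∀ s ∈ (insert s0 A)ᶜ, sgn s (insert s0 A) • v (insert s (insert s0 A))
        = - (sgn s0 A • (sgn s A • w (insert s A))) := by
      intro s hs
      simp only [mem_compl, mem_insert, not_or] at hs
      rw [hv, if_pos (by simp), Finset.insert_comm s s0 A,
        Finset.erase_insert (by simp [hA, Ne.symm hs.1]), sgn_insert_self (by simp [hA, Ne.symm hs.1]),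
        smul_smul, smul_smul]
      have := sgn_sq s0 A
      have h3 := sgn_swap hA hs.2 (Ne.symm hs.1)
      rw [← neg_smul]
      congr 1
      rw [sgn_insert hs.2, sgn_insert hA]
      rcases lt_or_gt_of_ne hs.1 with h | h
      · simp [h, h.not_gt]; ring
      · simp [h, h.not_gt]; ring
    rw [Finset.sum_congr rfl h2, Finset.sum_neg_distrib, ← Finset.smul_sum,
      ← eq_neg_of_add_eq_zero_right h1 |>.symm, smul_neg, smul_smul, sgn_sq]
    simp
  · unfold bd
    rw [Finset.sum_eq_single s0]
    · rw [hv, if_pos (by simp), Finset.erase_insert h0, sgn_insert_self h0, smul_smul, sgn_sq, one_smul]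
    · intro s hs hne
      rw [hv, if_neg (by simp [h0, Ne.symm hne]), smul_zero]
    · intro h; simp [h0] at h

end Sign

section Mon

variable {k V : Type} [Field k] [DecidableEq V]

/-- exponent vector of squarefree monomial -/
noncomputable def ex (A : Finset V) : V →₀ ℕ := ∑ v ∈ A, Finsupp.single v 1

/-- squarefree monomial -/
noncomputable def mon (k : Type) [Field k] (A : Finset V) : MvPolynomial V k := ∏ v ∈ A, X v

theorem ex_apply (A : Finset V) (v : V) : ex A v = if v ∈ A then 1 else 0 := by
  unfold ex
  simp [Finsupp.finsetSum_apply, Finsupp.single_apply]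

theorem mon_eq (A : Finset V) : mon k A = monomial (ex A) (1 : k) := by
  unfold mon ex
  rw [monomial_sum_one]
  rfl

theorem ex_le (A : Finset V) (c : V →₀ ℕ) : ex A ≤ c ↔ A ⊆ c.support := by
  constructor
  · intro h v hv
    have := h v
    rw [ex_apply, if_pos hv] at this
    simp; omega
  · intro h v
    rw [ex_apply]
    split_ifs with hv
    · have := h hv
      simp at this; omega
    · simp

theorem mon_ne (A : Finset V) : mon k A ≠ 0 := by
  rw [mon_eq]; simp

theorem coeff_mon_mul (A : Finset V) (p : MvPolynomial V k) (c : V →₀ ℕ)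
    (h : coeff c (mon k A * p) ≠ 0) : A ⊆ c.support := by
  rw [mon_eq, coeff_monomial_mul'] at h
  by_contra h'
  rw [if_neg (by rwa [ex_le])] at h
  exact h rfl

theorem exists_mon_mul (A : Finset V) (p : MvPolynomial V k)
    (h : ∀ c, coeff c p ≠ 0 → A ⊆ c.support) : ∃ q, p = mon k A * q := by
  refine ⟨MvPolynomial.divMonomial p (ex A), ?_⟩
  ext c
  rw [mon_eq, coeff_monomial_mul']
  split_ifs with hc
  · rw [coeff_divMonomial, one_mul, add_tsub_cancel_of_le hc]
  · by_contra h'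
    exact hc ((ex_le _ _).2 (h c h'))

theorem mon_homog (A : Finset V) : (mon k A).IsHomogeneous A.card := by
  unfold mon
  have := MvPolynomial.IsHomogeneous.prod A (fun v => (X v : MvPolynomial V k)) (fun _ => 1)
    (fun v _ => isHomogeneous_X k v)
  simpa using this

theorem mon_const (A : Finset V) (h : A.Nonempty) : constantCoeff (mon k A) = 0 := by
  unfold mon
  obtain ⟨v, hv⟩ := h
  rw [map_prod]
  exact Finset.prod_eq_zero hv (by simp)

theorem mon_union {A B : Finset V} (h : Disjoint A B) : mon k (A ∪ B) = mon k A * mon k B :=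
  Finset.prod_union h

/-- restriction of a polynomial to monomials satisfying a predicate -/
noncomputable def restr (Q : (V →₀ ℕ) → Prop) [DecidablePred Q] (p : MvPolynomial V k) :
    MvPolynomial V k := ∑ c ∈ p.support with Q c, monomial c (coeff c p)

theorem coeff_restr (Q : (V →₀ ℕ) → Prop) [DecidablePred Q] (p : MvPolynomial V k) (c : V →₀ ℕ) :
    coeff c (restr Q p) = if Q c then coeff c p else 0 := by
  unfold restr
  rw [coeff_sum]
  simp only [coeff_monomial]
  rw [Finset.sum_ite_eq' ]
  by_cases h : Q c <;> by_cases h2 : coeff c p = 0 <;> simp [h, h2]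

end Mon

section Taylor

variable {k V : Type} [Field k] [DecidableEq V] {N : ℕ} (P : Fin N → Finset V)

/-- support of the lcm -/
def U (S : Finset (Fin N)) : Finset V := S.biUnion P

theorem U_insert (s : Fin N) (S : Finset (Fin N)) : U P (insert s S) = P s ∪ U P S := by
  unfold U; rw [Finset.biUnion_insert]

theorem mem_U {S : Finset (Fin N)} {s : Fin N} (h : s ∈ S) : P s ⊆ U P S := by
  unfold U; exact Finset.subset_biUnion_of_mem P h

/-- The quotient of consecutive lcms. -/
noncomputable def ratio (k : Type) [Field k] (s : Fin N) (S : Finset (Fin N)) : MvPolynomial V k :=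
  mon k (U P (insert s S) \ U P S)

theorem mul_ratio (s : Fin N) (S : Finset (Fin N)) :
    mon k (U P S) * ratio P k s S = mon k (U P (insert s S)) := by
  unfold ratio
  rw [← mon_union Finset.disjoint_sdiff, Finset.union_sdiff_of_subset]
  rw [U_insert]; exact Finset.subset_union_right

/-- Taylor differential on all subsets at once. -/
noncomputable def td (k : Type) [Field k] :
    (Finset (Fin N) → MvPolynomial V k) →ₗ[MvPolynomial V k] (Finset (Fin N) → MvPolynomial V k) where
  toFun y S := ∑ s ∈ Sᶜ, sgn s S • (ratio P k s S * y (insert s S))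
  map_add' y z := by
    funext S
    simp only [Pi.add_apply, mul_add, smul_add, Finset.sum_add_distrib]
  map_smul' c y := by
    funext S
    simp only [Pi.smul_apply, smul_eq_mul, RingHom.id_apply, Finset.mul_sum]
    refine Finset.sum_congr rfl fun s _ => ?_
    rw [mul_smul_comm, mul_left_comm]

theorem td_apply (y : Finset (Fin N) → MvPolynomial V k) (S : Finset (Fin N)) :
    td P k y S = ∑ s ∈ Sᶜ, sgn s S • (ratio P k s S * y (insert s S)) := rfl

theorem mul_td (y : Finset (Fin N) → MvPolynomial V k) (S : Finset (Fin N)) :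
    mon k (U P S) * td P k y S = bd (fun S => mon k (U P S) * y S) S := by
  rw [td_apply, Finset.mul_sum]
  unfold bd
  refine Finset.sum_congr rfl fun s _ => ?_
  rw [mul_smul_comm, ← mul_assoc, mul_ratio]

theorem td_td (y : Finset (Fin N) → MvPolynomial V k) : td P k (td P k y) = 0 := by
  funext S
  have h := mul_td P (td P k y) S
  have h2 : (fun S => mon k (U P S) * td P k y S) = bd (fun S => mon k (U P S) * y S) := by
    funext S; exact mul_td P y S
  rw [h2, bd_bd] at h
  exact (mul_eq_zero.1 h).resolve_left (mon_ne _)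

theorem coeff_bd (w : Finset (Fin N) → MvPolynomial V k) (c : V →₀ ℕ) (S : Finset (Fin N)) :
    coeff c (bd w S) = bd (fun S => coeff c (w S)) S := by
  unfold bd
  rw [coeff_sum]
  refine Finset.sum_congr rfl fun s _ => ?_
  exact map_zsmul (MvPolynomial.coeffAddMonoidHom c) _ _

theorem exact_core (w : Finset (Fin N) → MvPolynomial V k)
    (hdiv : ∀ S c, coeff c (w S) ≠ 0 → U P S ⊆ c.support)
    (hs : ∀ S c, coeff c (w S) ≠ 0 → ∃ s, P s ⊆ c.support)
    (hcyc : ∀ S, bd w S = 0) :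
    ∃ v : Finset (Fin N) → MvPolynomial V k, (∀ S, bd v S = w S) ∧
      (∀ S c, coeff c (v S) ≠ 0 → U P S ⊆ c.support) ∧
      (∀ S, v S ≠ 0 → ∃ s ∈ S, w (S.erase s) ≠ 0) := by
  classical
  obtain ⟨s0, hs0, hs0'⟩ : ∃ s0 : (V →₀ ℕ) → Option (Fin N),
      (∀ c s, s0 c = some s → P s ⊆ c.support) ∧ (∀ c, s0 c = none → ∀ s, ¬ P s ⊆ c.support) := by
    refine ⟨fun c => if h : ∃ s, P s ⊆ c.support then some h.choose else none, ?_, ?_⟩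
    · intro c s h
      dsimp only at h
      split_ifs at h with h1
      rw [← Option.some.inj h]
      exact h1.choose_spec
    · intro c h s hs
      dsimp only at h
      rw [dif_pos ⟨s, hs⟩] at h
      cases h
  have hco : ∀ (S : Finset (Fin N)) (c : V →₀ ℕ),
      coeff c (∑ s ∈ S, sgn s S • restr (fun c => s0 c = some s) (w (S.erase s))) =
      ∑ s ∈ S, if s0 c = some s then sgn s S • coeff c (w (S.erase s)) else 0 := by
    intro S c
    rw [coeff_sum]
    refine Finset.sum_congr rfl fun s _ => ?_
    rw [show coeff c (sgn s S • restr (fun c => s0 c = some s) (w (S.erase s))) =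
      sgn s S • coeff c (restr (fun c => s0 c = some s) (w (S.erase s))) from
      map_zsmul (MvPolynomial.coeffAddMonoidHom c) _ _, coeff_restr]
    split_ifs <;> simp
  refine ⟨fun S => ∑ s ∈ S, sgn s S • restr (fun c => s0 c = some s) (w (S.erase s)), ?_, ?_, ?_⟩
  · intro S
    ext c
    rw [coeff_bd]
    rcases h : s0 c with _ | s
    · have h1 : ∀ S, coeff c (w S) = 0 := by
        intro S
        by_contra h'
        obtain ⟨s, hs⟩ := hs S c h'
        exact hs0' c h s hs
      rw [h1]
      unfold bd
      apply Finset.sum_eq_zero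
      intro s _
      dsimp only
      rw [hco]
      simp [h]
    · refine bd_cone (fun S => coeff c (w S)) _ s ?_ ?_ S
      · intro S
        rw [← coeff_bd, hcyc]; simp
      · intro S
        rw [hco]
        simp only [h, Option.some.injEq]
        rw [Finset.sum_ite_eq]
  · intro S c hc
    rw [hco] at hc
    obtain ⟨s, hsS, hne⟩ := Finset.exists_ne_zero_of_sum_ne_zero hc
    split_ifs at hne with h
    · have h1 : coeff c (w (S.erase s)) ≠ 0 := by
        intro h0; rw [h0] at hne; simp at hne
      have h2 := hdiv _ _ h1
      rw [← Finset.insert_erase hsS, U_insert]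
      exact Finset.union_subset (hs0 c s h) h2
    · exact absurd rfl hne
  · intro S hS
    obtain ⟨s, hsS, hne⟩ := Finset.exists_ne_zero_of_sum_ne_zero hS
    refine ⟨s, hsS, fun h0 => hne ?_⟩
    rw [h0]
    simp [restr]

theorem td_exact (y : Finset (Fin N) → MvPolynomial V k)
    (hs : ∀ S c, coeff c (mon k (U P S) * y S) ≠ 0 → ∃ s, P s ⊆ c.support)
    (hcyc : td P k y = 0) :
    ∃ z : Finset (Fin N) → MvPolynomial V k, td P k z = y ∧
      (∀ S, z S ≠ 0 → ∃ s ∈ S, y (S.erase s) ≠ 0) := by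
  obtain ⟨v, hv1, hv2, hv3⟩ := exact_core P (fun S => mon k (U P S) * y S)
    (fun S c h => coeff_mon_mul _ _ _ h) hs (fun S => by rw [← mul_td, hcyc]; simp)
  choose z hz using fun S => exists_mon_mul (U P S) (v S) (hv2 S)
  refine ⟨z, ?_, ?_⟩
  · funext S
    apply mul_left_cancel₀ (mon_ne (k := k) (U P S))
    rw [mul_td, ← hv1 S]
    congr 1
    funext S
    exact (hz S).symm
  · intro S hS
    obtain ⟨s, h1, h2⟩ := hv3 S (by rw [hz]; exact mul_ne_zero (mon_ne _) hS)
    exact ⟨s, h1, fun h => h2 (by rw [h]; simp)⟩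

/-- rank -/
def bb (N i : ℕ) : ℕ := Fintype.card {S : Finset (Fin N) // S.card = i}

/-- indexing -/
noncomputable def idx (N i : ℕ) : Fin (bb N i) ≃ {S : Finset (Fin N) // S.card = i} :=
  (Fintype.equivFin _).symm

/-- Restriction to sets of size `i`. -/
noncomputable def pull (N i : ℕ) (R : Type) [CommRing R] :
    (Finset (Fin N) → R) →ₗ[R] (Fin (bb N i) → R) where
  toFun y j := y (idx N i j).1
  map_add' _ _ := rfl
  map_smul' _ _ := rfl

/-- Extension by zero. -/
noncomputable def push (N i : ℕ) (R : Type) [CommRing R] :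
    (Fin (bb N i) → R) →ₗ[R] (Finset (Fin N) → R) where
  toFun z S := if h : S.card = i then z ((idx N i).symm ⟨S, h⟩) else 0
  map_add' _ _ := by
    funext S
    by_cases h : S.card = i <;> simp [h]
  map_smul' _ _ := by
    funext S
    by_cases h : S.card = i <;> simp [h]

theorem pull_push {i : ℕ} {R : Type} [CommRing R] (z : Fin (bb N i) → R) :
    pull N i R (push N i R z) = z := by
  funext j
  change (if h : (idx N i j).1.card = i then z ((idx N i).symm ⟨_, h⟩) else 0) = z j
  rw [dif_pos (idx N i j).2]
  simp

theorem push_pull {i : ℕ} {R : Type} [CommRing R] (y : Finset (Fin N) → R)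
    (hy : ∀ S, S.card ≠ i → y S = 0) : push N i R (pull N i R y) = y := by
  funext S
  change (if h : S.card = i then y (idx N i ((idx N i).symm ⟨S, h⟩)).1 else 0) = y S
  split_ifs with h
  · simp
  · exact (hy S h).symm

theorem push_of_ne {i : ℕ} {R : Type} [CommRing R] (z : Fin (bb N i) → R) (S : Finset (Fin N))
    (h : S.card ≠ i) : push N i R z S = 0 := dif_neg h

theorem push_single {i : ℕ} {R : Type} [CommRing R] (j : Fin (bb N i)) (S : Finset (Fin N)) :
    push N i R (Pi.single j 1) S = if S = (idx N i j).1 then 1 else 0 := by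
  by_cases h : S.card = i
  · change (if h : S.card = i then (Pi.single j 1 : Fin (bb N i) → R) ((idx N i).symm ⟨S, h⟩) else 0) = _
    rw [dif_pos h, Pi.single_apply]
    congr 1
    rw [Equiv.symm_apply_eq, Subtype.ext_iff]
  · rw [push_of_ne _ _ h, if_neg]
    rintro rfl
    exact h (idx N i j).2

theorem td_push_supp {i : ℕ} (z : Fin (bb N (i + 1)) → MvPolynomial V k) (S : Finset (Fin N))
    (h : S.card ≠ i) : td P k (push N (i + 1) _ z) S = 0 := by
  rw [td_apply]
  apply Finset.sum_eq_zero
  intro s hs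
  rw [push_of_ne, mul_zero, smul_zero]
  rw [Finset.card_insert_of_notMem (by simpa using hs)]
  omega

/-- The Taylor differential. -/
noncomputable def dd (k : Type) [Field k] (i : ℕ) :
    (Fin (bb N (i + 1)) → MvPolynomial V k) →ₗ[MvPolynomial V k] (Fin (bb N i) → MvPolynomial V k) :=
  (pull N i _) ∘ₗ (td P k) ∘ₗ (push N (i + 1) _)

theorem push_dd (i : ℕ) (z : Fin (bb N (i + 1)) → MvPolynomial V k) :
    push N i _ (dd P k i z) = td P k (push N (i + 1) _ z) :=
  push_pull _ fun S h => td_push_supp P z S h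

theorem push_inj {i : ℕ} {R : Type} [CommRing R] {y z : Fin (bb N i) → R}
    (h : push N i R y = push N i R z) : y = z := by
  rw [← pull_push y, h, pull_push]

theorem dd_exact_aux (i : ℕ) (z : Fin (bb N i) → MvPolynomial V k)
    (hs : ∀ S c, coeff c (mon k (U P S) * push N i _ z S) ≠ 0 → ∃ s, P s ⊆ c.support)
    (h : td P k (push N i _ z) = 0) : ∃ z', dd P k i z' = z := by
  obtain ⟨y, hy, hy2⟩ := td_exact P _ hs h
  refine ⟨pull N (i + 1) _ y, push_inj ?_⟩
  rw [push_dd, push_pull, hy]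
  intro S hS
  by_contra h0
  obtain ⟨s, h1, h2⟩ := hy2 S h0
  apply h2
  apply push_of_ne
  rw [Finset.card_erase_of_mem h1]
  have := Finset.card_pos.2 ⟨s, h1⟩
  omega

theorem dd_exact (i : ℕ) : Function.Exact (dd P k (i + 1)) (dd P k i) := by
  intro z
  constructor
  · intro h
    have h1 : td P k (push N (i + 1) _ z) = 0 := by
      rw [← push_dd, h, map_zero]
    refine dd_exact_aux P (i + 1) z ?_ h1
    intro S c hc
    have hS : S.card = i + 1 := by
      by_contra hS
      rw [push_of_ne _ _ hS] at hc
      simp at hc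
    obtain ⟨s, hs⟩ := Finset.card_pos.1 (show 0 < S.card by omega)
    exact ⟨s, (mem_U P hs).trans (coeff_mon_mul _ _ _ hc)⟩
  · rintro ⟨y, rfl⟩
    apply push_inj
    rw [push_dd, push_dd, td_td, map_zero]

/-- The squarefree monomial ideal. -/
noncomputable def II (k : Type) [Field k] : Ideal (MvPolynomial V k) :=
  Ideal.span (Set.range fun s => mon k (P s))

theorem mem_II {p : MvPolynomial V k} (hp : p ∈ II P k) (c : V →₀ ℕ) (hc : coeff c p ≠ 0) :
    ∃ s, P s ⊆ c.support := by
  unfold II at hp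
  induction hp using Submodule.span_induction generalizing c with
  | mem x h =>
    obtain ⟨s, rfl⟩ := h
    exact ⟨s, coeff_mon_mul (k := k) (P s) 1 c (by simpa using hc)⟩
  | zero => simp at hc
  | add x y _ _ hx hy =>
    rw [coeff_add] at hc
    by_cases h : coeff c x = 0
    · exact hy c (by simpa [h] using hc)
    · exact hx c h
  | smul a x _ hx =>
    rw [smul_eq_mul, coeff_mul] at hc
    obtain ⟨⟨c1, c2⟩, h1, h2⟩ := Finset.exists_ne_zero_of_sum_ne_zero hc
    obtain ⟨s, hs⟩ := hx c2 (right_ne_zero_of_mul h2)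
    refine ⟨s, hs.trans ?_⟩
    rw [HasAntidiagonal.mem_antidiagonal] at h1
    rw [← h1]
    intro v hv
    simp at hv ⊢
    omega

/-- augmentation -/
noncomputable def au (k : Type) [Field k] :
    (Fin (bb N 0) → MvPolynomial V k) →ₗ[MvPolynomial V k] (MvPolynomial V k ⧸ II P k) :=
  (Submodule.mkQ (II P k)) ∘ₗ (LinearMap.proj ∅) ∘ₗ (push N 0 _)

theorem au_apply (z : Fin (bb N 0) → MvPolynomial V k) :
    au P k z = Ideal.Quotient.mk (II P k) (push N 0 _ z ∅) := rfl

theorem au_const (p : MvPolynomial V k) :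
    au P k (fun _ => p) = Ideal.Quotient.mk (II P k) p := by
  rw [au_apply]; rfl

theorem idx_zero (j : Fin (bb N 0)) : (idx N 0 j).1 = ∅ := Finset.card_eq_zero.1 (idx N 0 j).2

theorem dd_exact_zero : Function.Exact (dd P k 0) (au P k) := by
  intro z
  rw [au_apply, Ideal.Quotient.eq_zero_iff_mem]
  constructor
  · intro h
    refine dd_exact_aux P 0 z ?_ ?_
    · intro S c hc
      have hS : S.card = 0 := by
        by_contra hS
        rw [push_of_ne _ _ hS] at hc
        simp at hc
      rw [Finset.card_eq_zero] at hS
      subst hS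
      refine mem_II P h c ?_
      simpa [U, mon] using hc
    · funext S
      rw [td_apply]
      apply Finset.sum_eq_zero
      intro s _
      rw [push_of_ne, mul_zero, smul_zero]
      simp
  · rintro ⟨y, rfl⟩
    rw [push_dd, td_apply]
    refine Ideal.sum_mem _ fun s _ => ?_
    refine Submodule.smul_of_tower_mem _ _ ?_
    apply Ideal.mul_mem_right
    apply Ideal.subset_span
    refine ⟨s, ?_⟩
    simp [ratio, U]

/-- The Taylor resolution is minimal when each new set enlarges the union. -/
noncomputable def taylor (k : Type) [Field k]
    (hmin : ∀ s S, s ∉ S → (U P (insert s S) \ U P S).Nonempty) :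
    MinFreeRes k V (II P k) where
  b := bb N
  deg i j := (U P (idx N i j).1).card
  d := dd P k
  aug := au P k
  aug_surjective := by
    intro x
    obtain ⟨p, rfl⟩ := Ideal.Quotient.mk_surjective x
    exact ⟨fun _ => p, au_const P p⟩
  exact_zero := dd_exact_zero P
  exact_succ := dd_exact P
  aug_homog := by
    intro j
    refine ⟨1, ?_, ?_⟩
    · rw [idx_zero]; simpa [U] using isHomogeneous_one V k
    · rw [au_apply, push_single, idx_zero, if_pos rfl]
  d_homog := by
    intro i j l
    have key : dd P k i (Pi.single j 1) l = ∑ s ∈ ((idx N i l).1)ᶜ, sgn s (idx N i l).1 •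
        (ratio P k s (idx N i l).1 * if insert s (idx N i l).1 = (idx N (i + 1) j).1 then 1 else 0) := by
      change td P k (push N (i + 1) _ (Pi.single j 1)) (idx N i l).1 = _
      rw [td_apply]
      simp_rw [push_single]
    rw [key]
    constructor
    · apply IsHomogeneous.sum
      intro s _
      split_ifs with h
      · rw [mul_one, ← h, ← Finset.card_sdiff_of_subset (by rw [U_insert]; exact Finset.subset_union_right)]
        have h1 : ratio P k s (idx N i l).1 ∈ homogeneousSubmodule V k
          (U P (insert s (idx N i l).1) \ U P (idx N i l).1).card := mon_homog _
        exact zsmul_mem h1 _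
      · rw [mul_zero, smul_zero]; exact isHomogeneous_zero _ _ _
    · intro hlt
      apply Finset.sum_eq_zero
      intro s _
      rw [if_neg, mul_zero, smul_zero]
      intro h
      rw [← h, U_insert] at hlt
      exact absurd (Finset.card_le_card (Finset.subset_union_right)) (not_le.2 hlt)
  minimal := by
    intro i j l
    change constantCoeff (td P k (push N (i + 1) _ (Pi.single j 1)) (idx N i l).1) = 0
    rw [td_apply, map_sum]
    apply Finset.sum_eq_zero
    intro s hs
    rw [map_zsmul, map_mul]
    unfold ratio
    rw [mon_const _ (hmin s _ (by simpa using hs)), zero_mul, smul_zero]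

end Taylor

section Compare

variable {k σ : Type} [Field k]

/-- homogeneous of degree `a - b` -/
def Hg (p : MvPolynomial σ k) (a b : ℕ) : Prop := ∀ c, coeff c p ≠ 0 → c.degree + b = a

theorem Hg.of {p : MvPolynomial σ k} {a b : ℕ} (h : p.IsHomogeneous (a - b) ∧ (a < b → p = 0)) :
    Hg p a b := by
  intro c hc
  by_cases hab : a < b
  · rw [h.2 hab] at hc; simp at hc
  · have h1 := h.1 hc
    have h2 : c.degree = Finsupp.weight 1 c := DFunLike.congr_fun (Finsupp.degree_eq_weight_one (R := ℕ)) c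
    omega

theorem Hg.sum {α : Type} {a b : ℕ} (s : Finset α) (f : α → MvPolynomial σ k)
    (h : ∀ x ∈ s, Hg (f x) a b) : Hg (∑ x ∈ s, f x) a b := by
  intro c hc
  rw [coeff_sum] at hc
  obtain ⟨x, hx, hx2⟩ := Finset.exists_ne_zero_of_sum_ne_zero hc
  exact h x hx c hx2

theorem Hg.mul {p q : MvPolynomial σ k} {a b d : ℕ} (hp : Hg p a b) (hq : Hg q b d) :
    Hg (p * q) a d := by
  classical
  intro c hc
  rw [coeff_mul] at hc
  obtain ⟨⟨c1, c2⟩, h1, h2⟩ := Finset.exists_ne_zero_of_sum_ne_zero hc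
  have e1 := hp c1 (left_ne_zero_of_mul h2)
  have e2 := hq c2 (right_ne_zero_of_mul h2)
  rw [HasAntidiagonal.mem_antidiagonal] at h1
  dsimp only at h1
  rw [← h1, map_add]
  omega

open Classical in
/-- graded component -/
noncomputable def cmp (p : MvPolynomial σ k) (a b : ℕ) : MvPolynomial σ k :=
  restr (fun c => c.degree + b = a) p

open Classical in
theorem coeff_cmp (p : MvPolynomial σ k) (a b : ℕ) (c : σ →₀ ℕ) :
    coeff c (cmp p a b) = if c.degree + b = a then coeff c p else 0 := coeff_restr _ _ _

theorem cmp_Hg (p : MvPolynomial σ k) (a b : ℕ) : Hg (cmp p a b) a b := by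
  intro c hc
  rw [coeff_cmp] at hc
  by_contra h
  rw [if_neg h] at hc
  exact hc rfl

theorem cmp_mul {q : MvPolynomial σ k} {b d : ℕ} (p : MvPolynomial σ k) (a : ℕ) (hq : Hg q b d) :
    cmp p a b * q = cmp (p * q) a d := by
  classical
  ext c
  rw [coeff_cmp, coeff_mul, coeff_mul]
  have key : ∀ x ∈ HasAntidiagonal.antidiagonal c, coeff x.1 (cmp p a b) * coeff x.2 q =
      if c.degree + d = a then coeff x.1 p * coeff x.2 q else 0 := by
    rintro ⟨c1, c2⟩ hx
    rw [HasAntidiagonal.mem_antidiagonal] at hx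
    dsimp only at hx ⊢
    by_cases hq0 : coeff c2 q = 0
    · simp [hq0]
    · have h2 := hq c2 hq0
      rw [coeff_cmp, ← hx, map_add]
      have : c1.degree + b = a ↔ c1.degree + c2.degree + d = a := by omega
      simp only [this]
      split_ifs <;> simp
  rw [Finset.sum_congr rfl key]
  split_ifs <;> simp

theorem cmp_of_Hg {p : MvPolynomial σ k} {a b : ℕ} (h : Hg p a b) : cmp p a b = p := by
  ext c
  rw [coeff_cmp]
  split_ifs with h1
  · rfl
  · by_contra h2
    exact h1 (h c (Ne.symm h2))

theorem cmp_sum {α : Type} (s : Finset α) (f : α → MvPolynomial σ k) (a b : ℕ) :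
    cmp (∑ x ∈ s, f x) a b = ∑ x ∈ s, cmp (f x) a b := by
  ext c
  rw [coeff_cmp, coeff_sum, coeff_sum]
  simp only [coeff_cmp]
  split_ifs <;> simp

theorem lin_apply {R : Type} [CommRing R] {m n : ℕ} (f : (Fin m → R) →ₗ[R] (Fin n → R))
    (x : Fin m → R) (l : Fin n) : f x l = ∑ j, x j * f (Pi.single j 1) l := by
  conv_lhs => rw [LinearMap.pi_apply_eq_sum_univ f x]
  rw [Finset.sum_apply]
  refine Finset.sum_congr rfl fun j _ => ?_
  rw [Pi.smul_apply, smul_eq_mul]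
  have : (fun i => if j = i then (1 : R) else 0) = Pi.single j 1 := by
    funext i
    simp [Pi.single_apply, eq_comm]
  rw [this]

theorem exists_lin {R M : Type} [CommRing R] [AddCommGroup M] [Module R M] {m : ℕ}
    (v : Fin m → M) : ∃ f : (Fin m → R) →ₗ[R] M, ∀ j, f (Pi.single j 1) = v j := by
  refine ⟨(Pi.basisFun R (Fin m)).constr R v, fun j => ?_⟩
  rw [← Pi.basisFun_apply, Module.Basis.constr_basis]

theorem lin_ext {R M : Type} [CommRing R] [AddCommGroup M] [Module R M] {m : ℕ}
    {f g : (Fin m → R) →ₗ[R] M} (h : ∀ j, f (Pi.single j 1) = g (Pi.single j 1)) : f = g := by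
  apply (Pi.basisFun R (Fin m)).ext
  intro j
  rw [Pi.basisFun_apply, h]

variable {I : Ideal (MvPolynomial σ k)}

/-- constant terms of boundaries vanish -/
theorem const_d (F : MinFreeRes k σ I) (i : ℕ) (x : Fin (F.b (i + 1)) → MvPolynomial σ k)
    (l : Fin (F.b i)) : constantCoeff (F.d i x l) = 0 := by
  rw [lin_apply, map_sum]
  apply Finset.sum_eq_zero
  intro j _
  rw [map_mul, F.minimal, mul_zero]

theorem graded_lift (G : MinFreeRes k σ I) (i n : ℕ) (w : Fin (G.b i) → MvPolynomial σ k)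
    (hw : ∀ l, Hg (w l) n (G.deg i l)) (y : Fin (G.b (i + 1)) → MvPolynomial σ k)
    (hy : G.d i y = w) :
    ∃ y', G.d i y' = w ∧ ∀ l, Hg (y' l) n (G.deg (i + 1) l) := by
  refine ⟨fun l => cmp (y l) n (G.deg (i + 1) l), ?_, fun l => cmp_Hg _ _ _⟩
  funext l
  rw [← cmp_of_Hg (hw l), ← hy, lin_apply, lin_apply _ y, cmp_sum]
  refine Finset.sum_congr rfl fun j _ => ?_
  exact cmp_mul _ _ (Hg.of (G.d_homog i j l))

/-- The inductive state of the comparison. -/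
def St (F G : MinFreeRes k σ I) (i : ℕ) : Prop :=
  ∃ (f : (Fin (F.b i) → MvPolynomial σ k) →ₗ[MvPolynomial σ k] (Fin (G.b i) → MvPolynomial σ k))
    (g : (Fin (G.b i) → MvPolynomial σ k) →ₗ[MvPolynomial σ k] (Fin (F.b i) → MvPolynomial σ k))
    (h : (Fin (F.b i) → MvPolynomial σ k) →ₗ[MvPolynomial σ k]
      (Fin (F.b (i + 1)) → MvPolynomial σ k)),
    (∀ j l, Hg (f (Pi.single j 1) l) (F.deg i j) (G.deg i l)) ∧
    (∀ x, ∃ y, G.d i y = f (F.d i x)) ∧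
    (∀ y, ∃ x, F.d i x = g (G.d i y)) ∧
    (∀ x, g (f (F.d i x)) - F.d i x = F.d i (h (F.d i x))) ∧
    (∀ x j, constantCoeff ((g (f x) - x) j) = 0)

theorem St_zero (F G : MinFreeRes k σ I)
    (hG : ∀ (p : MvPolynomial σ k) (n : ℕ), p.IsHomogeneous n → ∃ y,
      G.aug y = Ideal.Quotient.mk I p ∧ ∀ l, Hg (y l) n (G.deg 0 l)) : St F G 0 := by
  have h1 : ∀ j, ∃ y, G.aug y = F.aug (Pi.single j 1) ∧ ∀ l, Hg (y l) (F.deg 0 j) (G.deg 0 l) := by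
    intro j
    obtain ⟨p, hp, hp2⟩ := F.aug_homog j
    rw [hp2]
    exact hG p _ hp
  choose v hv hv2 using h1
  choose u hu using fun l => F.aug_surjective (G.aug (Pi.single l 1))
  obtain ⟨f, hf⟩ := exists_lin (R := MvPolynomial σ k) v
  obtain ⟨g, hg⟩ := exists_lin (R := MvPolynomial σ k) u
  have hf' : ∀ x, G.aug (f x) = F.aug x := by
    intro x
    have : G.aug ∘ₗ f = F.aug := lin_ext fun j => by simp [hf, hv]
    exact LinearMap.congr_fun this x
  have hg' : ∀ x, F.aug (g x) = G.aug x := by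
    intro x
    have : F.aug ∘ₗ g = G.aug := lin_ext fun j => by simp [hg, hu]
    exact LinearMap.congr_fun this x
  have h2 : ∀ j, ∃ y, F.d 0 y = g (f (Pi.single j 1)) - Pi.single j 1 := by
    intro j
    apply (F.exact_zero _).1
    rw [map_sub, hg', hf', sub_self]
  choose t ht using h2
  obtain ⟨h, hh⟩ := exists_lin (R := MvPolynomial σ k) t
  have hh' : ∀ x, g (f x) - x = F.d 0 (h x) := by
    intro x
    have : g ∘ₗ f - LinearMap.id = F.d 0 ∘ₗ h := lin_ext fun j => by simp [hh, ht]
    exact LinearMap.congr_fun this x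
  refine ⟨f, g, h, ?_, ?_, ?_, ?_, ?_⟩
  · intro j l; rw [hf]; exact hv2 j l
  · intro x
    apply (G.exact_zero _).1
    rw [hf']
    exact (F.exact_zero _).2 ⟨x, rfl⟩
  · intro x
    apply (F.exact_zero _).1
    rw [hg']
    exact (G.exact_zero _).2 ⟨x, rfl⟩
  · intro x; exact hh' _
  · intro x j
    rw [hh']
    exact const_d F 0 _ j

theorem St_succ (F G : MinFreeRes k σ I) (i : ℕ) (hS : St F G i) : St F G (i + 1) := by
  obtain ⟨f0, g0, h0, hgr, hfd, hgd, hh0, -⟩ := hS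
  have h1 : ∀ j, ∃ y, G.d i y = f0 (F.d i (Pi.single j 1)) ∧
      ∀ l, Hg (y l) (F.deg (i + 1) j) (G.deg (i + 1) l) := by
    intro j
    obtain ⟨y, hy⟩ := hfd (Pi.single j 1)
    refine graded_lift G i _ _ ?_ y hy
    intro l
    rw [lin_apply]
    refine Hg.sum _ _ fun m _ => ?_
    exact (Hg.of (F.d_homog i j m)).mul (hgr m l)
  choose v hv hv2 using h1
  choose u hu using fun l => hgd (Pi.single l 1)
  obtain ⟨f, hf⟩ := exists_lin (R := MvPolynomial σ k) v
  obtain ⟨g, hg⟩ := exists_lin (R := MvPolynomial σ k) u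
  have hf' : ∀ x, G.d i (f x) = f0 (F.d i x) := by
    intro x
    have : G.d i ∘ₗ f = f0 ∘ₗ F.d i := lin_ext fun j => by simp [hf, hv]
    exact LinearMap.congr_fun this x
  have hg' : ∀ x, F.d i (g x) = g0 (G.d i x) := by
    intro x
    have : F.d i ∘ₗ g = g0 ∘ₗ G.d i := lin_ext fun j => by simp [hg, hu]
    exact LinearMap.congr_fun this x
  have h2 : ∀ j, ∃ y, F.d (i + 1) y = g (f (Pi.single j 1)) - Pi.single j 1
      - h0 (F.d i (Pi.single j 1)) := by
    intro j
    apply (F.exact_succ i _).1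
    rw [map_sub, map_sub, hg', hf', hh0, sub_self]
  choose t ht using h2
  obtain ⟨h, hh⟩ := exists_lin (R := MvPolynomial σ k) t
  have hh' : ∀ x, g (f x) - x - h0 (F.d i x) = F.d (i + 1) (h x) := by
    intro x
    have : g ∘ₗ f - LinearMap.id - h0 ∘ₗ F.d i = F.d (i + 1) ∘ₗ h :=
      lin_ext fun j => by simp [hh, ht]
    exact LinearMap.congr_fun this x
  have hFd : ∀ x, F.d i (F.d (i + 1) x) = 0 := fun x => (F.exact_succ i _).2 ⟨x, rfl⟩
  have hGd : ∀ x, G.d i (G.d (i + 1) x) = 0 := fun x => (G.exact_succ i _).2 ⟨x, rfl⟩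
  refine ⟨f, g, h, ?_, ?_, ?_, ?_, ?_⟩
  · intro j l; rw [hf]; exact hv2 j l
  · intro x
    apply (G.exact_succ i _).1
    rw [hf', hFd, map_zero]
  · intro x
    apply (F.exact_succ i _).1
    rw [hg', hGd, map_zero]
  · intro x
    rw [← hh', hFd, map_zero, sub_zero]
  · intro x j
    rw [sub_eq_iff_eq_add.1 (hh' x), Pi.add_apply, map_add, const_d, zero_add, lin_apply, map_sum]
    apply Finset.sum_eq_zero
    intro m _
    rw [map_mul, const_d, zero_mul]

theorem deg_mem (F G : MinFreeRes k σ I)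
    (hG : ∀ (p : MvPolynomial σ k) (n : ℕ), p.IsHomogeneous n → ∃ y,
      G.aug y = Ideal.Quotient.mk I p ∧ ∀ l, Hg (y l) n (G.deg 0 l))
    (i : ℕ) (j : Fin (F.b i)) : ∃ l : Fin (G.b i), G.deg i l = F.deg i j := by
  have hS : St F G i := by
    clear j
    induction i with
    | zero => exact St_zero F G hG
    | succ i ih => exact St_succ F G i ih
  obtain ⟨f, g, h, hgr, -, -, -, hc⟩ := hS
  by_contra hcon
  push Not at hcon
  have h1 := hc (Pi.single j 1) j
  rw [Pi.sub_apply, map_sub, lin_apply g, map_sum, Finset.sum_eq_zero] at h1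
  · simp at h1
  · intro l _
    rw [map_mul]
    have : constantCoeff (f (Pi.single j 1) l) = 0 := by
      by_contra h2
      have := hgr j l 0 (by rwa [constantCoeff_eq] at h2)
      simp at this
      exact hcon l this
    rw [this, zero_mul]

end Compare

section Tree

variable {V : Type} [Fintype V] [DecidableEq V] (T : RTree V)

theorem level_root : T.level T.root = 0 := by
  unfold RTree.level
  rw [Nat.find_eq_zero]; rfl

theorem level_of_ne {v : V} (h : v ≠ T.root) : T.level v = T.level (T.parent v) + 1 :=
  Nat.find_comp_succ (T.reach v) (T.reach (T.parent v)) h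

theorem level_parent (v : V) : T.level (T.parent v) = T.level v - 1 := by
  by_cases h : v = T.root
  · subst h; rw [T.parent_root, level_root]
  · rw [level_of_ne T h]; simp

theorem level_iter (v : V) (j : ℕ) : T.level (T.parent^[j] v) = T.level v - j := by
  induction j with
  | zero => rfl
  | succ j ih => rw [Function.iterate_succ_apply', level_parent, ih]; omega

theorem level_le (v : V) : T.level v ≤ T.height :=
  Finset.le_sup (f := fun v => T.level v) (Finset.mem_univ v)

/-- vertices of the path to `v` -/
noncomputable def path (v : V) : Finset V := (Finset.range (T.height + 1)).image fun j => T.parent^[j] v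

theorem iter_inj {v : V} (hv : T.level v = T.height) :
    Set.InjOn (fun j => T.parent^[j] v) (Finset.range (T.height + 1)) := by
  intro a ha b hb hab
  have h1 := congrArg T.level hab
  dsimp only at h1
  rw [level_iter, level_iter] at h1
  simp at ha hb
  omega

theorem pathMonomial_eq (k : Type) [Field k] {v : V} (hv : T.level v = T.height) :
    T.pathMonomial k (T.height + 1) v = mon k (path T v) := by
  unfold RTree.pathMonomial mon path
  rw [Finset.prod_image (iter_inj T hv)]

theorem self_mem_path (v : V) : v ∈ path T v := by
  unfold path
  exact Finset.mem_image.2 ⟨0, by simp, rfl⟩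

theorem eq_of_mem_path (hh : 1 ≤ T.height) {u v : V} (hu : T.level u = T.height)
    (hv : T.level v = T.height) (h : u ∈ path T v) : u = v := by
  obtain ⟨j, hj, rfl⟩ := Finset.mem_image.1 h
  rw [level_iter] at hu
  obtain rfl : j = 0 := by omega
  rfl

theorem exists_leaf (hperf : T.Perfect) (n : ℕ) : ∀ u : V, T.height = T.level u + n →
    ∃ v, T.level v = T.height ∧ T.parent^[n] v = u := by
  induction n with
  | zero => intro u hu; exact ⟨u, hu.symm, rfl⟩
  | succ n ih =>
    intro u hu
    have hnl : ¬ T.IsLeaf u := fun h => by have := hperf u h; omega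
    unfold RTree.IsLeaf at hnl
    push Not at hnl
    obtain ⟨y, hy, hyr⟩ := hnl
    have h1 := level_of_ne T hyr
    rw [hy] at h1
    obtain ⟨v, hv, hvy⟩ := ih y (by omega)
    exact ⟨v, hv, by rw [Function.iterate_succ_apply', hvy, hy]⟩

theorem mem_path_leaf (hperf : T.Perfect) (u : V) : ∃ v, T.level v = T.height ∧ u ∈ path T v := by
  have := level_le T u
  obtain ⟨v, hv, h⟩ := exists_leaf T hperf (T.height - T.level u) u (by omega)
  refine ⟨v, hv, Finset.mem_image.2 ⟨_, ?_, h⟩⟩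
  simp

theorem count_inner (hh : 1 ≤ T.height) :
    ((Finset.univ.filter fun v => T.level v < T.height).card : ℤ) =
      1 + ∑ x : V, (if T.level x + 2 ≤ T.height then (T.outdeg x : ℤ) else 0) := by
  classical
  have h1 : (Finset.univ.filter fun v => T.level v < T.height) =
      insert T.root (Finset.univ.filter fun v => v ≠ T.root ∧ T.level v < T.height) := by
    ext v
    simp only [Finset.mem_filter, Finset.mem_univ, true_and, Finset.mem_insert]
    constructor
    · intro h
      by_cases hv : v = T.root
      · exact Or.inl hv
      · exact Or.inr ⟨hv, h⟩
    · rintro (rfl | h)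
      · rw [level_root]; omega
      · exact h.2
  rw [h1, Finset.card_insert_of_notMem (by simp)]
  have h2 : ∀ x : V, (if T.level x + 2 ≤ T.height then T.outdeg x else 0) =
      ((Finset.univ.filter fun v => v ≠ T.root ∧ T.level v < T.height).filter
        fun v => T.parent v = x).card := by
    intro x
    split_ifs with h
    · unfold RTree.outdeg
      rw [Nat.card_eq_fintype_card, Fintype.card_subtype]
      congr 1
      ext y
      simp only [Finset.mem_filter, Finset.mem_univ, true_and]
      constructor
      · rintro ⟨rfl, hy⟩
        have := level_of_ne T hy
        exact ⟨⟨hy, by omega⟩, rfl⟩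
      · rintro ⟨⟨hy, _⟩, h3⟩
        exact ⟨h3, hy⟩
    · symm
      rw [Finset.card_eq_zero, Finset.filter_eq_empty_iff]
      intro y hy
      simp only [Finset.mem_filter, Finset.mem_univ, true_and] at hy
      rintro rfl
      have := level_of_ne T hy.1
      omega
  rw [Finset.card_eq_sum_card_fiberwise (f := T.parent) (t := Finset.univ) (by intro x _; simp)]
  simp only [← h2]
  push_cast
  rw [add_comm]

end Tree

end TaylorRes

/-- Theorem 3.1: for a perfect rooted tree of height `h ≥ 1` and `t = h + 1`,
`reg(R/I_t(Γ)) = 1 + Σ_{0 ≤ ℓ(x) ≤ h-2} deg⁺(x)`. -/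
theorem reg_path_ideal_perfect_height_add_one
    {k V : Type} [Field k] [Fintype V] [DecidableEq V] (T : RTree V)
    (hh : 1 ≤ T.height) (hperf : T.Perfect) :
    reg k V (T.pathIdeal k (T.height + 1)) =
      1 + ∑ x : V, (if T.level x + 2 ≤ T.height then (T.outdeg x : ℤ) else 0) := by
  classical
  obtain ⟨N, ⟨e⟩⟩ : ∃ N, Nonempty (Fin N ≃ {v : V // T.level v = T.height}) :=
    ⟨_, ⟨(Fintype.equivFin _).symm⟩⟩
  let P : Fin N → Finset V := fun s => TaylorRes.path T (e s).1
  have hI : T.pathIdeal k (T.height + 1) = TaylorRes.II P k := by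
    unfold RTree.pathIdeal TaylorRes.II
    congr 1
    ext m
    constructor
    · rintro ⟨v, hv, rfl⟩
      have hv' : T.level v = T.height := by
        have := TaylorRes.level_le T v
        omega
      refine ⟨e.symm ⟨v, hv'⟩, ?_⟩
      rw [TaylorRes.pathMonomial_eq T k hv']
      simp [P]
    · rintro ⟨s, rfl⟩
      exact ⟨(e s).1, by rw [(e s).2], (TaylorRes.pathMonomial_eq T k (e s).2).symm⟩
  have hleaf : ∀ s S, (e s).1 ∈ TaylorRes.U P S → s ∈ S := by
    intro s S h
    obtain ⟨r, hr, hr2⟩ := Finset.mem_biUnion.1 h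
    have := TaylorRes.eq_of_mem_path T hh (e s).2 (e r).2 hr2
    rw [e.injective (Subtype.ext this)]
    exact hr
  have hleaf' : ∀ s S, s ∈ S → (e s).1 ∈ TaylorRes.U P S := fun s S h =>
    TaylorRes.mem_U P h (TaylorRes.self_mem_path T _)
  have hmin : ∀ s S, s ∉ S → (TaylorRes.U P (insert s S) \ TaylorRes.U P S).Nonempty := by
    intro s S hs
    refine ⟨(e s).1, Finset.mem_sdiff.2 ⟨hleaf' _ _ (by simp), fun h => hs (hleaf s S h)⟩⟩
  rw [hI, ← TaylorRes.count_inner T hh]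
  have hcard : ∀ S : Finset (Fin N), (TaylorRes.U P S).card =
      ((TaylorRes.U P S).filter fun v => T.level v < T.height).card + S.card := by
    intro S
    rw [← Finset.card_filter_add_card_filter_not (s := TaylorRes.U P S)
      (fun v => T.level v < T.height)]
    congr 1
    rw [← Finset.card_image_of_injective S (f := fun s => (e s).1)
      (Subtype.val_injective.comp e.injective)]
    congr 1
    ext v
    simp only [Finset.mem_filter, Finset.mem_image]
    constructor
    · rintro ⟨h1, h2⟩
      have hv : T.level v = T.height := by
        have := TaylorRes.level_le T v
        omega
      refine ⟨e.symm ⟨v, hv⟩, hleaf _ _ (by simpa using h1), by simp⟩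
    · rintro ⟨s, hs, rfl⟩
      exact ⟨hleaf' s S hs, by rw [(e s).2]; omega⟩
  apply IsGreatest.csSup_eq
  constructor
  · refine ⟨TaylorRes.taylor P k hmin, N, (TaylorRes.idx N N).symm ⟨Finset.univ, by simp⟩, ?_⟩
    have h1 : (TaylorRes.taylor P k hmin).deg N
        ((TaylorRes.idx N N).symm ⟨Finset.univ, by simp⟩) =
        (TaylorRes.U P Finset.univ).card := by
      change (TaylorRes.U P (TaylorRes.idx N N _).1).card = _
      rw [Equiv.apply_symm_apply]
    rw [h1, hcard]
    have h2 : TaylorRes.U P Finset.univ = Finset.univ := by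
      ext u
      simp only [Finset.mem_univ, iff_true]
      obtain ⟨v, hv, hu⟩ := TaylorRes.mem_path_leaf T hperf u
      refine TaylorRes.mem_U P (Finset.mem_univ (e.symm ⟨v, hv⟩)) ?_
      simpa [P] using hu
    rw [h2]
    simp
  · rintro x ⟨F, i, j, rfl⟩
    obtain ⟨l, hl⟩ := TaylorRes.deg_mem F (TaylorRes.taylor P k hmin) (by
      intro p n hp
      refine ⟨fun _ => p, TaylorRes.au_const P p, fun l => ?_⟩
      have h0 : (TaylorRes.taylor P k hmin).deg 0 l = 0 := by
        change (TaylorRes.U P (TaylorRes.idx N 0 l).1).card = 0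
        have h3 : ∀ m : Fin (TaylorRes.bb N 0), (TaylorRes.U P (TaylorRes.idx N 0 m).1).card = 0 := by
          intro m
          rw [TaylorRes.idx_zero]; rfl
        exact h3 l
      rw [h0]
      exact TaylorRes.Hg.of ⟨hp, fun h => absurd h (Nat.not_lt_zero _)⟩) i j
    rw [← hl]
    have h1 : (TaylorRes.taylor P k hmin).deg i l =
      (TaylorRes.U P (TaylorRes.idx N i l).1).card := rfl
    rw [h1, hcard, (TaylorRes.idx N i l).2]
    have h2 := Finset.card_le_card (Finset.filter_subset_filter (fun v => T.level v < T.height)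
      (Finset.subset_univ (TaylorRes.U P (TaylorRes.idx N i l).1)))
    push_cast
    omega
end

section
/- Let (Γ, x_0) be a perfect rooted tree of height h ≥ 1 and t = h. Then reg(R/I_t(Γ)) = Σ_{x : 0 ≤ ℓ(x) ≤ h−2} deg⁺(x). -/
open MvPolynomial

set_option linter.unusedSectionVars false
set_option linter.unusedSimpArgs false

section Koszul

variable {k V : Type} [Field k] [Fintype V] [DecidableEq V]

namespace PK

noncomputable def tau (v u : V) : ℤ :=
  if Fintype.equivFin V u < Fintype.equivFin V v then -1 else 1

theorem tau_mul (v u : V) (h : u ≠ v) : tau v u * tau u v = -1 := by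
  have : Fintype.equivFin V u ≠ Fintype.equivFin V v := fun e => h ((Fintype.equivFin V).injective e)
  unfold tau
  rcases lt_or_gt_of_ne this with h1 | h1
  · simp [h1, h1.le]
  · simp [h1, h1.le]

theorem tau_sq (v u : V) : tau v u * tau v u = 1 := by
  unfold tau; split_ifs <;> simp

noncomputable def sgn (v : V) (A : Finset V) : ℤ := ∏ u ∈ A, tau v u

theorem sgn_insert (v u : V) (A : Finset V) (h : u ∉ A) :
    sgn v (insert u A) = tau v u * sgn v A := Finset.prod_insert h

theorem sgn_sq (v : V) (A : Finset V) : sgn v A * sgn v A = 1 := by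
  unfold sgn; rw [← Finset.prod_mul_distrib]; exact Finset.prod_eq_one fun u _ => tau_sq v u

variable {N N' : Type} [AddCommGroup N] [Module (MvPolynomial V k) N]
  [AddCommGroup N'] [Module (MvPolynomial V k) N']

noncomputable def io (v : V) : (Finset V → N) →ₗ[MvPolynomial V k] (Finset V → N) where
  toFun f A := if v ∈ A then 0 else sgn v A • f (insert v A)
  map_add' f g := by ext A; by_cases h : v ∈ A <;> simp [h]
  map_smul' r f := by
    ext A; by_cases h : v ∈ A
    · simp [h]
    · simp [h]; exact smul_comm _ _ _

/-- exterior multiplication with `e_v`. -/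
noncomputable def ep (v : V) : (Finset V → N) →ₗ[MvPolynomial V k] (Finset V → N) where
  toFun f A := if v ∈ A then sgn v (A.erase v) • f (A.erase v) else 0
  map_add' f g := by ext A; by_cases h : v ∈ A <;> simp [h]
  map_smul' r f := by
    ext A; by_cases h : v ∈ A
    · simp [h]; exact smul_comm _ _ _
    · simp [h]

theorem io_apply (v : V) (f : Finset V → N) (A : Finset V) :
    io (k := k) v f A = if v ∈ A then 0 else sgn v A • f (insert v A) := rfl

theorem ep_apply (v : V) (f : Finset V → N) (A : Finset V) :
    ep (k := k) v f A = if v ∈ A then sgn v (A.erase v) • f (A.erase v) else 0 := rfl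

theorem io_io (v : V) (f : Finset V → N) : io (k := k) v (io (k := k) v f) = 0 := by
  ext A; simp [io_apply]

theorem io_anti (v u : V) (f : Finset V → N) :
    io (k := k) v (io (k := k) u f) = - io (k := k) u (io (k := k) v f) := by
  by_cases huv : u = v
  · subst huv; simp [io_io]
  ext A
  have huv' : v ≠ u := fun h => huv h.symm
  by_cases hv : v ∈ A
  · simp [io_apply, hv]
  by_cases hu : u ∈ A
  · simp [io_apply, hu]
  simp only [io_apply, Pi.neg_apply, hv, hu, if_false, Finset.mem_insert, huv, huv', or_false]
  rw [sgn_insert _ _ _ hu, sgn_insert _ _ _ hv, Finset.insert_comm, smul_smul, smul_smul, ← neg_smul]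
  congr 1
  have h1 := tau_mul v u huv
  have h2 := tau_sq v u
  have h3 : tau u v = - tau v u := by
    calc tau u v = (tau v u * tau v u) * tau u v := by rw [h2, one_mul]
      _ = tau v u * (tau v u * tau u v) := by ring
      _ = _ := by rw [h1]; ring
  rw [h3]; ring

theorem io_ep_ne (v u : V) (huv : u ≠ v) (f : Finset V → N) :
    io (k := k) v (ep (k := k) u f) = - ep (k := k) u (io (k := k) v f) := by
  ext A
  have huv' : v ≠ u := fun h => huv h.symm
  by_cases hv : v ∈ A
  · by_cases hu : u ∈ A <;> simp [io_apply, ep_apply, hv, hu, huv']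
  by_cases hu : u ∈ A
  · obtain ⟨B, hB, rfl⟩ : ∃ B, u ∉ B ∧ A = insert u B :=
      ⟨A.erase u, Finset.notMem_erase _ _, (Finset.insert_erase hu).symm⟩
    have hvB : v ∉ B := fun h => hv (Finset.mem_insert_of_mem h)
    have e1 : (insert v (insert u B)).erase u = insert v B := by
      rw [Finset.insert_comm, Finset.erase_insert]; simp [huv, hB]
    simp only [io_apply, ep_apply, Pi.neg_apply, hv, if_false, Finset.mem_insert, huv', huv, hvB,
      true_or, or_true, if_true, e1, or_false, Finset.erase_insert hB]
    rw [sgn_insert _ _ _ hB, sgn_insert _ _ _ hvB, smul_smul, smul_smul, ← neg_smul]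
    congr 1
    have h1 := tau_mul v u huv
    have h2 := tau_sq v u
    have h3 : tau u v = - tau v u := by
      calc tau u v = (tau v u * tau v u) * tau u v := by rw [h2, one_mul]
        _ = tau v u * (tau v u * tau u v) := by ring
        _ = _ := by rw [h1]; ring
    rw [h3]
    linear_combination (-sgn v B * sgn u B) * h2
  · simp [io_apply, ep_apply, hv, hu, huv]

theorem io_ep (v : V) (f : Finset V → N) :
    io (k := k) v (ep (k := k) v f) = f - ep (k := k) v (io (k := k) v f) := by
  ext A
  by_cases hv : v ∈ A
  · simp [io_apply, ep_apply, hv, smul_smul, sgn_sq]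
  · simp [io_apply, ep_apply, hv, smul_smul, sgn_sq]

/-- partial Koszul differential. -/
noncomputable def kdW (W : Finset V) : (Finset V → N) →ₗ[MvPolynomial V k] (Finset V → N) :=
  ∑ v ∈ W, (X v : MvPolynomial V k) • io v

theorem kdW_apply (W : Finset V) (f : Finset V → N) :
    kdW (k := k) W f = ∑ v ∈ W, (X v : MvPolynomial V k) • io (k := k) v f := by
  simp [kdW]

noncomputable def kd : (Finset V → N) →ₗ[MvPolynomial V k] (Finset V → N) := kdW Finset.univ

theorem kdW_io (W : Finset V) (v : V) (f : Finset V → N) :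
    kdW (k := k) W (io (k := k) v f) = - io (k := k) v (kdW (k := k) W f) := by
  rw [kdW_apply, kdW_apply, map_sum, ← Finset.sum_neg_distrib]
  refine Finset.sum_congr rfl fun u _ => ?_
  rw [map_smul, io_anti, smul_neg]

theorem kdW_ep_notMem (W : Finset V) (v : V) (hv : v ∉ W) (f : Finset V → N) :
    kdW (k := k) W (ep (k := k) v f) = - ep (k := k) v (kdW (k := k) W f) := by
  rw [kdW_apply, kdW_apply, map_sum, ← Finset.sum_neg_distrib]
  refine Finset.sum_congr rfl fun u hu => ?_
  rw [map_smul, io_ep_ne _ _ (by rintro rfl; exact hv hu), smul_neg]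

theorem kd_ep (v : V) (f : Finset V → N) :
    kd (k := k) (ep (k := k) v f) = (X v : MvPolynomial V k) • f - ep (k := k) v (kd (k := k) f) := by
  have h : (Finset.univ : Finset V) = insert v (Finset.univ.erase v) := by simp
  have h2 : ∀ g : Finset V → N, kd (k := k) g
      = (X v : MvPolynomial V k) • io (k := k) v g + kdW (k := k) (Finset.univ.erase v) g := by
    intro g
    rw [kd, kdW_apply, kdW_apply, h, Finset.sum_insert (by simp)]
    simp
  rw [h2, h2, kdW_ep_notMem _ _ (by simp), io_ep, map_add, map_smul, smul_sub]
  abel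

theorem kdW_kdW (W : Finset V) (f : Finset V → N) : kdW (k := k) W (kdW (k := k) W f) = 0 := by
  induction W using Finset.induction_on with
  | empty => simp [kdW]
  | insert v W hv ih =>
    have h2 : ∀ g : Finset V → N, kdW (k := k) (insert v W) g
      = (X v : MvPolynomial V k) • io (k := k) v g + kdW (k := k) W g := by
      intro g
      rw [kdW_apply, kdW_apply, Finset.sum_insert hv]
    rw [h2, h2, map_add, map_add, map_smul, map_smul, io_io, ih, kdW_io]
    simp

theorem kd_kd (f : Finset V → N) : kd (k := k) (kd (k := k) f) = 0 := kdW_kdW _ f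

theorem kd_apply (f : Finset V → N) (A : Finset V) :
    kd (k := k) f A = ∑ v, (X v : MvPolynomial V k) • (if v ∈ A then 0 else sgn v A • f (insert v A)) := by
  rw [kd, kdW_apply, Finset.sum_apply]; rfl

/-- Koszul differential commutes with linear maps. -/
theorem kd_map (φ : N →ₗ[MvPolynomial V k] N') (f : Finset V → N) :
    kd (k := k) (fun A => φ (f A)) = fun A => φ (kd (k := k) f A) := by
  ext A
  rw [kd_apply, kd_apply, map_sum]
  refine Finset.sum_congr rfl fun v _ => ?_
  by_cases hv : v ∈ A <;> simp [hv]

theorem kd_mem (J : Submodule (MvPolynomial V k) N) (f : Finset V → N) (h : ∀ A, f A ∈ J) (A) :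
    kd (k := k) f A ∈ J := by
  rw [kd_apply]
  refine J.sum_mem fun v _ => J.smul_mem _ ?_
  split_ifs
  · exact J.zero_mem
  · exact zsmul_mem (h _) _

theorem ep_mem (J : Submodule (MvPolynomial V k) N) (v : V) (f : Finset V → N) (h : ∀ A, f A ∈ J) (A) :
    ep (k := k) v f A ∈ J := by
  rw [ep_apply]
  split_ifs
  · exact zsmul_mem (h _) _
  · exact J.zero_mem

abbrev Rg (k V : Type) [Field k] := MvPolynomial V k

theorem X_mul_mem_span (W : Finset V) (v : V) (hv : v ∉ W) (p : MvPolynomial V k)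
    (h : X v * p ∈ Ideal.span (X '' (W : Set V) : Set (MvPolynomial V k))) :
    p ∈ Ideal.span (X '' (W : Set V) : Set (MvPolynomial V k)) := by
  rw [MvPolynomial.mem_ideal_span_X_image] at h ⊢
  intro m hm
  have : (Finsupp.single v 1 + m) ∈ (X v * p).support := by
    rw [MvPolynomial.mem_support_iff, MvPolynomial.coeff_X_mul]
    exact MvPolynomial.mem_support_iff.mp hm
  obtain ⟨i, hi, hi'⟩ := h _ this
  refine ⟨i, hi, ?_⟩
  have : v ≠ i := by rintro rfl; exact hv (by simpa using hi)
  simpa [Finsupp.single_apply, this] using hi'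

theorem kdW_exact (W : Finset V) : ∀ f : Finset V → MvPolynomial V k,
    (∀ A, ¬ A ⊆ W → f A = 0) → kdW (k := k) W f = 0 →
    f ∅ ∈ Ideal.span (X '' (W : Set V) : Set (MvPolynomial V k)) →
    ∃ g : Finset V → MvPolynomial V k, (∀ A, ¬ A ⊆ W → g A = 0) ∧ kdW (k := k) W g = f := by
  induction W using Finset.induction_on with
  | empty =>
    intro f hf _ h0
    refine ⟨0, by simp, ?_⟩
    ext1 A
    rcases A.eq_empty_or_nonempty with rfl | hA
    · simp at h0; simp [h0]
    · rw [hf A (by simpa [Finset.subset_empty] using hA.ne_empty)]; simp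
  | insert v W hv ih =>
    intro f hf hd h0
    have h2 : ∀ g : Finset V → MvPolynomial V k, kdW (k := k) (insert v W) g
      = (X v : MvPolynomial V k) • io (k := k) v g + kdW (k := k) W g := by
      intro g
      rw [kdW_apply, kdW_apply, Finset.sum_insert hv]
    rw [h2] at hd
    set b := io (k := k) v f with hb
    have hbW : ∀ A, ¬ A ⊆ W → b A = 0 := by
      intro A hA
      rw [hb, io_apply]
      split_ifs with h
      · rfl
      · rw [hf, smul_zero]
        intro h3
        apply hA
        intro x hx
        have := h3 (Finset.mem_insert_of_mem hx)
        rcases Finset.mem_insert.mp this with rfl | h4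
        · exact absurd hx h
        · exact h4
    have hdb : kdW (k := k) W b = 0 := by
      have := congrArg (io (k := k) v) hd
      rw [map_add, map_smul, hb, io_io, smul_zero, zero_add, map_zero] at this
      rw [hb, kdW_io, this, neg_zero]
    have hb0 : b ∅ ∈ Ideal.span (X '' (W : Set V) : Set (MvPolynomial V k)) := by
      apply X_mul_mem_span W v hv
      have h3 := congrFun hd ∅
      simp only [Pi.add_apply, Pi.smul_apply, smul_eq_mul, Pi.zero_apply] at h3
      rw [eq_neg_of_add_eq_zero_left h3, kdW_apply, Finset.sum_apply]
      refine neg_mem (Ideal.sum_mem _ fun u hu => ?_)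
      rw [Pi.smul_apply, smul_eq_mul]
      exact Ideal.mul_mem_right _ _ (Ideal.subset_span ⟨u, hu, rfl⟩)
    obtain ⟨b', hb'W, hb'⟩ := ih b hbW hdb hb0
    rw [Finset.coe_insert, Set.image_insert_eq, Ideal.mem_span_insert] at h0
    obtain ⟨q, p, hp, hfe⟩ := h0
    set b2 : Finset V → MvPolynomial V k := Function.update b' ∅ (-q) with hb2
    have hb2W : ∀ A, ¬ A ⊆ W → b2 A = 0 := by
      intro A hA
      have : A ≠ ∅ := by rintro rfl; simp at hA
      rw [hb2, Function.update_of_ne this, hb'W A hA]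
    have hdb2 : kdW (k := k) W b2 = b := by
      rw [← hb', kdW_apply, kdW_apply]
      refine Finset.sum_congr rfl fun u _ => ?_
      congr 1
      ext1 A
      rw [io_apply, io_apply, hb2, Function.update_of_ne (Finset.insert_ne_empty _ _)]
    have hvA : ∀ A, v ∈ A → ¬ A ⊆ W := fun A hA h => hv (h hA)
    obtain ⟨a', ha'W, ha'⟩ := ih (f - ep (k := k) v b + (X v : MvPolynomial V k) • b2) (by
        intro A hA
        rw [Pi.add_apply, Pi.sub_apply, Pi.smul_apply, hb2W A hA, ep_apply]
        split_ifs with h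
        · rw [hb, io_apply, if_neg (Finset.notMem_erase _ _), smul_smul, sgn_sq,
            Finset.insert_erase h]; simp
        · rw [hf A]; · simp
          intro h3
          apply hA
          intro x hx
          rcases Finset.mem_insert.mp (h3 hx) with rfl | h4
          · exact absurd hx h
          · exact h4) (by
        rw [map_add, map_sub, map_smul, hdb2, kdW_ep_notMem _ _ hv, hdb, map_zero, neg_zero, sub_zero,
          add_comm]
        exact hd) (by
        simp only [Pi.add_apply, Pi.sub_apply, Pi.smul_apply, ep_apply, Finset.notMem_empty, if_false,
          hb2, Function.update_self, hfe, smul_eq_mul]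
        convert hp using 1; ring)
    refine ⟨a' - ep (k := k) v b2, ?_, ?_⟩
    · intro A hA
      rw [Pi.sub_apply, ha'W A (fun h => hA (h.trans (Finset.subset_insert _ _))), ep_apply]
      split_ifs with h
      · rw [hb2W, smul_zero, sub_zero]
        intro h3
        apply hA
        rw [← Finset.insert_erase h]
        exact Finset.insert_subset_insert _ h3
      · simp
    · have e1 : io (k := k) v a' = 0 := by
        ext1 A; rw [io_apply]; split_ifs
        · rfl
        · rw [ha'W _ (hvA _ (Finset.mem_insert_self _ _))]; simp
      have e2 : io (k := k) v b2 = 0 := by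
        ext1 A; rw [io_apply]; split_ifs
        · rfl
        · rw [hb2W _ (hvA _ (Finset.mem_insert_self _ _))]; simp
      rw [h2, map_sub, map_sub, e1, io_ep, e2, map_zero, ha', kdW_ep_notMem _ _ hv, hdb2, smul_sub, smul_zero, zero_sub, sub_zero]
      abel

theorem kd_exact_one (f : Finset V → MvPolynomial V k) (hd : kd (k := k) f = 0)
    (h0 : constantCoeff (f ∅) = 0) : ∃ g : Finset V → MvPolynomial V k, kd (k := k) g = f := by
  obtain ⟨g, -, hg⟩ := kdW_exact Finset.univ f (fun A h => absurd (Finset.subset_univ A) h) hd (by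
    rw [MvPolynomial.mem_ideal_span_X_image]
    intro m hm
    by_contra hcon
    push Not at hcon
    have : m = 0 := by ext i; simpa using hcon i (by simp)
    subst this
    exact (MvPolynomial.mem_support_iff.mp hm) h0)
  exact ⟨g, hg⟩

theorem kd_exact {b : ℕ} (f : Finset V → Fin b → MvPolynomial V k) (hd : kd (k := k) f = 0)
    (h0 : ∀ j, constantCoeff (f ∅ j) = 0) :
    ∃ g : Finset V → Fin b → MvPolynomial V k, kd (k := k) g = f := by
  have : ∀ j : Fin b, ∃ g : Finset V → MvPolynomial V k, kd (k := k) g = fun A => f A j := by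
    intro j
    apply kd_exact_one _ _ (h0 j)
    have := kd_map (LinearMap.proj (R := MvPolynomial V k) (φ := fun _ : Fin b => MvPolynomial V k) j) f
    rw [hd] at this
    simp only [LinearMap.proj_apply, Pi.zero_apply] at this
    exact this
  choose g hg using this
  refine ⟨fun A j => g j A, ?_⟩
  ext1 A
  ext1 j
  have := kd_map (LinearMap.proj (R := MvPolynomial V k) (φ := fun _ : Fin b => MvPolynomial V k) j)
    (fun A j => g j A)
  have h3 := congrFun this A
  simp only [LinearMap.proj_apply] at h3
  rw [← h3]
  exact congrFun (hg j) A

end PK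
end Koszul
section Graded

variable {k V : Type} [Field k] [Fintype V] [DecidableEq V]

namespace PK

/-- homogeneous component, indexed by integers -/
noncomputable def hc (n : ℤ) : MvPolynomial V k →ₗ[k] MvPolynomial V k :=
  weightedHomogeneousComponent (fun _ => (1 : ℤ)) n

theorem coeff_hc (n : ℤ) (d : V →₀ ℕ) (p : MvPolynomial V k) :
    coeff d (hc n p) = if (d.degree : ℤ) = n then coeff d p else 0 := by
  rw [hc, coeff_weightedHomogeneousComponent]
  have : Finsupp.weight (fun _ : V => (1 : ℤ)) d = (d.degree : ℤ) := by
    simp [Finsupp.weight_apply, Finsupp.sum, Finsupp.degree_apply]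
  rw [this]

theorem hc_mul (n : ℤ) (s : ℕ) (a m : MvPolynomial V k) (hm : m.IsHomogeneous s) :
    hc (n + s) (a * m) = hc n a * m := by
  ext d
  rw [coeff_hc, coeff_mul, coeff_mul]
  split_ifs with h
  · refine Finset.sum_congr rfl fun x hx => ?_
    rw [coeff_hc]
    by_cases hx2 : coeff x.2 m = 0
    · simp [hx2]
    · have h1 : x.2.degree = s := by
        by_contra hne
        exact hx2 (hm.coeff_eq_zero hne)
      have h2 : x.1.degree + x.2.degree = d.degree := by
        rw [← Finset.HasAntidiagonal.mem_antidiagonal.mp hx, map_add]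
      rw [if_pos (by omega)]
  · symm
    refine Finset.sum_eq_zero fun x hx => ?_
    rw [coeff_hc]
    by_cases hx2 : coeff x.2 m = 0
    · simp [hx2]
    · have h1 : x.2.degree = s := by
        by_contra hne
        exact hx2 (hm.coeff_eq_zero hne)
      have h2 : x.1.degree + x.2.degree = d.degree := by
        rw [← Finset.HasAntidiagonal.mem_antidiagonal.mp hx, map_add]
      rw [if_neg (by omega), zero_mul]

theorem hc_idem (n : ℤ) (p : MvPolynomial V k) : hc n (hc n p) = hc n p := by
  ext d; simp only [coeff_hc]; split_ifs <;> rfl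

theorem hc_of_homog (s : ℕ) (p : MvPolynomial V k) (hp : p.IsHomogeneous s) : hc (s : ℤ) p = p := by
  ext d; rw [coeff_hc]; split_ifs with h
  · rfl
  · exact (hp.coeff_eq_zero (fun h2 => h (by exact_mod_cast h2))).symm

theorem homog_of_hc (s : ℕ) (p : MvPolynomial V k) (hp : hc (s : ℤ) p = p) : p.IsHomogeneous s := by
  intro d hd
  rw [← hp, coeff_hc] at hd
  have : (d.degree : ℤ) = s := by
    by_contra h; simp [h] at hd
  have h2 : d.degree = s := by exact_mod_cast this
  rw [← h2, Finsupp.degree_eq_weight_one]; rfl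

theorem zero_of_hc_neg (n : ℤ) (hn : n < 0) (p : MvPolynomial V k) : hc n p = 0 := by
  ext d; rw [coeff_hc, if_neg (by omega)]; simp

/-- projection of Koszul chains onto homological degree `p` and internal degree `D`. -/
noncomputable def P1 (p D : ℤ) : (Finset V → MvPolynomial V k) →ₗ[k] (Finset V → MvPolynomial V k) where
  toFun f A := if (A.card : ℤ) = p then hc (D - p) (f A) else 0
  map_add' f g := by ext1 A; by_cases h : (A.card : ℤ) = p <;> simp [h]
  map_smul' r f := by ext1 A; by_cases h : (A.card : ℤ) = p <;> simp [h]

theorem P1_apply (p D : ℤ) (f : Finset V → MvPolynomial V k) (A : Finset V) :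
    P1 p D f A = if (A.card : ℤ) = p then hc (D - p) (f A) else 0 := rfl

theorem P1_idem (p D : ℤ) (f : Finset V → MvPolynomial V k) : P1 p D (P1 p D f) = P1 p D f := by
  ext1 A; simp only [P1_apply]; split_ifs
  · exact hc_idem _ _
  · rfl

theorem P1_kd (p D : ℤ) (f : Finset V → MvPolynomial V k) :
    P1 p D (kd (k := k) f) = kd (k := k) (P1 (p + 1) D f) := by
  ext1 A
  rw [P1_apply, kd_apply, kd_apply]
  split_ifs with h
  · rw [map_sum]
    refine Finset.sum_congr rfl fun v _ => ?_
    by_cases hv : v ∈ A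
    · simp [hv]
    · have hX := hc_mul (D - (p + 1)) 1 (sgn v A • f (insert v A)) (X v) (isHomogeneous_X k v)
      have hc1 : (((insert v A).card : ℕ) : ℤ) = p + 1 := by
        rw [Finset.card_insert_of_notMem hv]; push_cast; omega
      rw [if_neg hv, if_neg hv, P1_apply, if_pos hc1, smul_eq_mul, smul_eq_mul, mul_comm,
        ← map_zsmul, mul_comm (X v), ← hX]
      congr 2
      push_cast; ring
  · symm
    refine Finset.sum_eq_zero fun v _ => ?_
    by_cases hv : v ∈ A
    · simp [hv]
    · have hc1 : (((insert v A).card : ℕ) : ℤ) ≠ p + 1 := by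
        rw [Finset.card_insert_of_notMem hv]; push_cast; omega
      rw [if_neg hv, P1_apply, if_neg hc1]; simp

theorem P1_mul (p D : ℤ) (s : ℕ) (m : MvPolynomial V k) (hm : m.IsHomogeneous s)
    (f : Finset V → MvPolynomial V k) :
    P1 p (D + s) (fun A => f A * m) = fun A => P1 p D f A * m := by
  ext1 A
  simp only [P1_apply]
  split_ifs
  · rw [← hc_mul _ s _ _ hm]; congr 1; ring_nf
  · simp

theorem P1_X (p D : ℤ) (y : V) (f : Finset V → MvPolynomial V k) :
    P1 p D ((X y : MvPolynomial V k) • f) = (X y : MvPolynomial V k) • P1 p (D - 1) f := by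
  have := P1_mul p (D - 1) 1 (X y) (isHomogeneous_X k y) f
  have e1 : ((X y : MvPolynomial V k) • f) = fun A => f A * X y := by
    ext1 A; simp [mul_comm]
  have e2 : ((X y : MvPolynomial V k) • P1 p (D - 1) f) = fun A => P1 p (D - 1) f A * X y := by
    ext1 A; simp [mul_comm]
  rw [e1, e2, ← this]
  congr 2; simp

/-- squarefree monomial ideal -/
noncomputable def MI (k : Type) [Field k] (S : Set (Finset V)) : Ideal (MvPolynomial V k) :=
  Ideal.span ((fun s : Finset V => ∏ v ∈ s, (X v : MvPolynomial V k)) '' S)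

theorem mem_MI (S : Set (Finset V)) (f : MvPolynomial V k) :
    f ∈ MI k S ↔ ∀ ξ ∈ f.support, ∃ s ∈ S, s ⊆ ξ.support := by
  have e : (fun s : Finset V => ∏ v ∈ s, (X v : MvPolynomial V k)) '' S =
      (fun s => monomial s (1 : k)) '' ((fun s : Finset V => ∑ v ∈ s, Finsupp.single v 1) '' S) := by
    rw [Set.image_image]
    refine Set.image_congr fun s _ => ?_
    rw [MvPolynomial.monomial_sum_one]
    rfl
  rw [MI, e, MvPolynomial.mem_ideal_span_monomial_image]
  refine forall₂_congr fun ξ _ => ?_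
  simp only [Set.exists_mem_image]
  refine exists_congr fun s => and_congr_right fun _ => ?_
  rw [Finsupp.le_def]
  have hh : ∀ i, (∑ v ∈ s, Finsupp.single v 1 : V →₀ ℕ) i = if i ∈ s then 1 else 0 := by
    intro i
    rw [Finsupp.finsetSum_apply]
    simp [Finsupp.single_apply]
  constructor
  · intro h v hv
    have := h v
    rw [hh, if_pos hv] at this
    rw [Finsupp.mem_support_iff]; omega
  · intro h v
    rw [hh]
    split_ifs with hv
    · have := Finsupp.mem_support_iff.mp (h hv); omega
    · omega

theorem mul_mem_MI (S : Set (Finset V)) (y : V) (f : MvPolynomial V k) :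
    X y * f ∈ MI k S ↔ f ∈ MI k ((fun s : Finset V => s.erase y) '' S) := by
  rw [mem_MI, mem_MI]
  have hs : ∀ ξ : V →₀ ℕ, (Finsupp.single y 1 + ξ).support = insert y ξ.support := by
    intro ξ; ext v
    by_cases h : v = y
    · subst h; simp
    · simp [Finsupp.single_apply, h, Ne.symm h]
  simp only [Set.exists_mem_image, ← Finset.subset_insert_iff]
  rw [MvPolynomial.support_X_mul]
  simp [hs]

theorem MI_congr (S S' : Set (Finset V)) (h : ∀ s ∈ S, ∃ s' ∈ S', s' ⊆ s) : MI k S ≤ MI k S' := by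
  intro f hf
  rw [mem_MI] at hf ⊢
  intro ξ hξ
  obtain ⟨s, hs, h1⟩ := hf ξ hξ
  obtain ⟨s', hs', h2⟩ := h s hs
  exact ⟨s', hs', h2.trans h1⟩

theorem prod_mem_MI (S : Set (Finset V)) (s t : Finset V) (hs : s ∈ S) (hst : s ⊆ t) :
    ∏ v ∈ t, (X v : MvPolynomial V k) ∈ MI k S :=
  MI_congr {t} S (by rintro _ rfl; exact ⟨s, hs, hst⟩) (Ideal.subset_span ⟨t, rfl, rfl⟩)

theorem P1_mem_MI (S : Set (Finset V)) (p D : ℤ) (f : Finset V → MvPolynomial V k)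
    (h : ∀ A, f A ∈ MI k S) (A : Finset V) : P1 p D f A ∈ MI k S := by
  rw [P1_apply]
  split_ifs
  · rw [mem_MI]
    intro ξ hξ
    apply (mem_MI S _).mp (h A)
    rw [mem_support_iff, coeff_hc] at hξ
    rw [mem_support_iff]
    intro h0
    simp [h0] at hξ
  · exact Ideal.zero_mem _

/-- the regularity bound `r`, expressed by Koszul homology -/
def Van (k : Type) [Field k] (S : Set (Finset V)) (r : ℕ) : Prop :=
  ∀ i D : ℤ, i + r < D → ∀ f : Finset V → MvPolynomial V k, P1 i D f = f →
    (∀ A, kd (k := k) f A ∈ MI k S) →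
    ∃ g : Finset V → MvPolynomial V k, ∀ A, f A - kd (k := k) g A ∈ MI k S

theorem Van.mono {S : Set (Finset V)} {r r' : ℕ} (h : Van k S r) (hr : r ≤ r') : Van k S r' :=
  fun i D hD => h i D (by omega)

theorem Van.congr {S S' : Set (Finset V)} {r : ℕ} (h : Van k S r)
    (h1 : ∀ s ∈ S, ∃ s' ∈ S', s' ⊆ s) (h2 : ∀ s ∈ S', ∃ s' ∈ S, s' ⊆ s) : Van k S' r := by
  have e : MI k S' = MI k S := le_antisymm (MI_congr _ _ h2) (MI_congr _ _ h1)
  unfold Van; rw [e]; exact h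

theorem mem_insert_single (S : Set (Finset V)) (y : V) (f : MvPolynomial V k) :
    f ∈ MI k (insert {y} S) ↔ ∃ u w, w ∈ MI k S ∧ f = X y * u + w := by
  rw [MI, Set.image_insert_eq, Ideal.mem_span_insert]
  simp only [Finset.prod_singleton]
  constructor
  · rintro ⟨a, z, hz, rfl⟩; exact ⟨a, z, hz, by ring⟩
  · rintro ⟨a, z, hz, rfl⟩; exact ⟨a, z, hz, by ring⟩

theorem Van_colon (S : Set (Finset V)) (y : V) (r : ℕ)
    (h1 : Van k ((fun s : Finset V => s.erase y) '' S) r) (h2 : Van k (insert {y} S) (r + 1)) :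
    Van k S (r + 1) := by
  intro i D hD f hf hcyc
  obtain ⟨g, hg⟩ := h2 i D hD f hf (fun A => MI_congr S _ (fun s hs => ⟨s, Or.inr hs, subset_rfl⟩) (hcyc A))
  simp only [mem_insert_single] at hg
  choose u w hw hfe using hg
  have e0 : f = kd (k := k) g + (X y : MvPolynomial V k) • u + w := by
    ext1 A; have := hfe A; simp only [Pi.add_apply, Pi.smul_apply, smul_eq_mul]
    linear_combination this
  have e1 : f = kd (k := k) (P1 (i+1) D g) + (X y : MvPolynomial V k) • P1 i (D-1) u + P1 i D w := by
    rw [← P1_kd, ← P1_X, ← map_add, ← map_add, ← e0, hf]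
  have hw' := P1_mem_MI S i D w hw
  set u0 := P1 i (D-1) u with hu0
  set w0 := P1 i D w with hw0
  obtain ⟨g1, hg1⟩ := h1 i (D-1) (by push_cast at hD; omega) u0 (P1_idem _ _ _) (fun A => by
    rw [← mul_mem_MI]
    have e2 : kd (k := k) f = (X y : MvPolynomial V k) • kd (k := k) u0 + kd (k := k) w0 := by
      rw [e1, map_add, map_add, kd_kd, map_smul, zero_add]
    have e3 := congrFun e2 A
    simp only [Pi.add_apply, Pi.smul_apply, smul_eq_mul] at e3
    rw [eq_sub_of_add_eq e3.symm]
    exact Ideal.sub_mem _ (hcyc A) (kd_mem (MI k S) w0 hw' A))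
  refine ⟨P1 (i+1) D g + (X y : MvPolynomial V k) • g1, fun A => ?_⟩
  have h3 := (mul_mem_MI S y _).mpr (hg1 A)
  have h4 := Ideal.add_mem _ h3 (hw' A)
  convert h4 using 1
  have e3 := congrFun e1 A
  simp only [Pi.add_apply, Pi.smul_apply, smul_eq_mul] at e3
  rw [e3, map_add, map_smul]
  simp only [Pi.add_apply, Pi.smul_apply, smul_eq_mul]
  ring

theorem Van_reg (S : Set (Finset V)) (y : V) (r : ℕ) (hy : ∀ s ∈ S, y ∉ s)
    (h1 : Van k S r) : Van k (insert {y} S) r := by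
  have hS : (fun s : Finset V => s.erase y) '' S = S := by
    ext s; constructor
    · rintro ⟨s, hs, rfl⟩; simpa [Finset.erase_eq_of_notMem (hy s hs)] using hs
    · intro hs; exact ⟨s, hs, Finset.erase_eq_of_notMem (hy s hs)⟩
  intro i D hD f hf hcyc
  simp only [mem_insert_single] at hcyc ⊢
  choose u w hw hfe using hcyc
  have e0 : kd (k := k) f = (X y : MvPolynomial V k) • u + w := by
    ext1 A; exact hfe A
  have e1 : kd (k := k) f = (X y : MvPolynomial V k) • P1 (i-1) (D-1) u + P1 (i-1) D w := by
    rw [← P1_X, ← map_add, ← e0, P1_kd]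
    simp [hf]
  have hw' := P1_mem_MI S (i-1) D w hw
  set u0 := P1 (i-1) (D-1) u with hu0
  set w0 := P1 (i-1) D w with hw0
  obtain ⟨g1, hg1⟩ := h1 (i-1) (D-1) (by omega) u0 (P1_idem _ _ _) (fun A => by
    rw [← hS, ← mul_mem_MI]
    have e2 := congrArg (kd (k := k)) e1
    rw [kd_kd, map_add, map_smul] at e2
    have e3 := congrFun e2 A
    simp only [Pi.add_apply, Pi.smul_apply, smul_eq_mul, Pi.zero_apply] at e3
    rw [eq_neg_of_add_eq_zero_left e3.symm]
    exact neg_mem (kd_mem (MI k S) w0 hw' A))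
  have e4 : P1 i D (f - (X y : MvPolynomial V k) • g1) = f - (X y : MvPolynomial V k) • P1 i (D-1) g1 := by
    rw [map_sub, hf, P1_X]
  have e5 : ∀ A, u0 A - kd (k := k) (P1 i (D-1) g1) A ∈ MI k S := by
    intro A
    have := P1_mem_MI S (i-1) (D-1) (u0 - kd (k := k) g1) hg1 A
    rw [map_sub, P1_kd, hu0, P1_idem, ← hu0] at this
    simpa using this
  set g0 := P1 i (D-1) g1
  obtain ⟨g2, hg2⟩ := h1 i D hD (f - (X y : MvPolynomial V k) • g0) (by
      rw [map_sub, hf, P1_X, P1_idem]) (fun A => by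
    have h3 := Ideal.add_mem _ (Ideal.mul_mem_left _ (X y) (e5 A)) (hw' A)
    convert h3 using 1
    rw [map_sub, map_smul, e1]
    simp only [Pi.add_apply, Pi.sub_apply, Pi.smul_apply, smul_eq_mul]
    ring)
  refine ⟨g2, fun A => ⟨g0 A, _, hg2 A, ?_⟩⟩
  simp only [Pi.sub_apply, Pi.smul_apply, smul_eq_mul]
  ring

theorem Van_empty : Van k (∅ : Set (Finset V)) 0 := by
  intro i D hD f hf hcyc
  have hM : MI k (∅ : Set (Finset V)) = ⊥ := by simp [MI]
  simp only [hM, Ideal.mem_bot] at hcyc ⊢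
  obtain ⟨g, hg⟩ := kd_exact_one f (funext hcyc) (by
    rw [← hf, P1_apply]
    split_ifs with h
    · rw [constantCoeff_eq, coeff_hc, if_neg]
      simp; omega
    · simp)
  exact ⟨g, fun A => by rw [hg, sub_self]⟩

theorem Van_vars (U : Finset V) : Van k ((fun u : V => ({u} : Finset V)) '' (U : Set V)) 0 := by
  induction U using Finset.induction_on with
  | empty => simpa using Van_empty
  | insert v U hv ih =>
    rw [Finset.coe_insert, Set.image_insert_eq]
    apply Van_reg _ _ _ _ ih
    rintro _ ⟨u, hu, rfl⟩ h
    rw [Finset.mem_singleton] at h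
    subst h; exact hv hu

theorem Van_main (W : Finset V) : ∀ S : Set (Finset V), (∀ s ∈ S, (s \ W).card ≤ 1) → Van k S W.card := by
  classical
  induction W using Finset.induction_on with
  | empty =>
    intro S hS
    by_cases h0 : ∅ ∈ S
    · intro i D hD f hf hcyc
      refine ⟨0, fun A => ?_⟩
      have : (1 : MvPolynomial V k) ∈ MI k S := Ideal.subset_span ⟨∅, h0, by simp⟩
      rw [(Ideal.eq_top_iff_one _).mpr this]; trivial
    · have := Van_vars (k := k) (Finset.univ.filter fun u : V => ({u} : Finset V) ∈ S)
      rw [Finset.card_empty]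
      convert this using 1
      ext s
      simp only [Finset.coe_filter, Finset.mem_univ, true_and, Set.mem_image, Set.mem_ofPred_eq]
      constructor
      · intro hs
        have h1 := hS s hs
        simp only [Finset.sdiff_empty] at h1
        have h2 : s.card ≠ 0 := by
          intro h; rw [Finset.card_eq_zero] at h; subst h; exact h0 hs
        obtain ⟨u, rfl⟩ := Finset.card_eq_one.mp (show s.card = 1 by omega)
        exact ⟨u, hs, rfl⟩
      · rintro ⟨u, hu, rfl⟩; exact hu
  | insert y W hy ih =>
    intro S hS
    rw [Finset.card_insert_of_notMem hy]
    apply Van_colon S y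
    · apply ih
      rintro _ ⟨s, hs, rfl⟩
      refine le_trans (Finset.card_le_card ?_) (hS s hs)
      intro x; simp; tauto
    · apply Van.mono _ (Nat.le_succ _)
      apply Van.congr (ih (insert {y} {s ∈ S | y ∉ s}) _)
      · rintro s (rfl | hs)
        · exact ⟨_, Or.inl rfl, subset_rfl⟩
        · exact ⟨s, Or.inr hs.1, subset_rfl⟩
      · rintro s (rfl | hs)
        · exact ⟨_, Or.inl rfl, subset_rfl⟩
        · by_cases hys : y ∈ s
          · exact ⟨_, Or.inl rfl, by simpa using hys⟩
          · exact ⟨s, Or.inr ⟨hs, hys⟩, subset_rfl⟩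
      · rintro s (rfl | hs)
        · exact le_trans (Finset.card_le_card Finset.sdiff_subset) (by simp)
        · refine le_trans (Finset.card_le_card ?_) (hS s hs.1)
          intro x hx
          simp only [Finset.mem_sdiff, Finset.mem_insert] at hx ⊢
          refine ⟨hx.1, ?_⟩
          rintro (rfl | h)
          · exact hs.2 hx.1
          · exact hx.2 h

end PK
end Graded
section Zig

variable {k V : Type} [Field k] [Fintype V] [DecidableEq V]

namespace PK

theorem hc_sum {b : ℕ} (D : ℤ) (x M : Fin b → MvPolynomial V k) (e : Fin b → ℤ)
    (hM : ∀ j, M j = 0 ∨ ∃ s : ℕ, (M j).IsHomogeneous s ∧ (s : ℤ) = e j) :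
    hc D (∑ j, x j * M j) = ∑ j, hc (D - e j) (x j) * M j := by
  rw [map_sum]
  refine Finset.sum_congr rfl fun j _ => ?_
  rcases hM j with h | ⟨s, hs, he⟩
  · simp [h]
  · rw [← hc_mul _ s _ _ hs, he]; congr 1; ring_nf

theorem P1_sum {b : ℕ} (p D : ℤ) (f : Finset V → Fin b → MvPolynomial V k)
    (M : Fin b → MvPolynomial V k) (e : Fin b → ℤ)
    (hM : ∀ j, M j = 0 ∨ ∃ s : ℕ, (M j).IsHomogeneous s ∧ (s : ℤ) = e j) (A : Finset V) :
    P1 p D (fun A => ∑ j, f A j * M j) A = ∑ j, P1 p (D - e j) (fun A => f A j) A * M j := by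
  simp only [P1_apply]
  split_ifs
  · rw [hc_sum _ _ _ _ hM]
    refine Finset.sum_congr rfl fun j _ => ?_
    congr 3; ring_nf
  · simp

noncomputable def PP {b : ℕ} (δ : Fin b → ℕ) (p D : ℤ) (f : Finset V → Fin b → MvPolynomial V k) :
    Finset V → Fin b → MvPolynomial V k :=
  fun A j => P1 p (D - δ j) (fun A => f A j) A

theorem PP_idem {b : ℕ} (δ : Fin b → ℕ) (p D : ℤ) (f : Finset V → Fin b → MvPolynomial V k) :
    PP δ p D (PP δ p D f) = PP δ p D f := by
  ext1 A; ext1 j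
  exact congrFun (P1_idem p (D - δ j) (fun A => f A j)) A

theorem kd_proj {b : ℕ} (f : Finset V → Fin b → MvPolynomial V k) (A : Finset V) (j : Fin b) :
    kd (k := k) f A j = kd (k := k) (fun A => f A j) A :=
  (congrFun (kd_map (LinearMap.proj (R := MvPolynomial V k) (φ := fun _ : Fin b => MvPolynomial V k) j)
    f) A).symm

theorem PP_kd {b : ℕ} (δ : Fin b → ℕ) (p D : ℤ) (f : Finset V → Fin b → MvPolynomial V k) :
    PP δ p D (kd (k := k) f) = kd (k := k) (PP δ (p + 1) D f) := by
  ext1 A; ext1 j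
  rw [kd_proj]
  unfold PP
  simp only [kd_proj]
  exact congrFun (P1_kd p (D - δ j) (fun A => f A j)) A

theorem lin_expand {b : ℕ} {N : Type} [AddCommGroup N] [Module (MvPolynomial V k) N]
    (φ : (Fin b → MvPolynomial V k) →ₗ[MvPolynomial V k] N)
    (x : Fin b → MvPolynomial V k) : φ x = ∑ j, x j • φ (Pi.single j 1) := by
  conv_lhs => rw [← Finset.univ_sum_single x]
  rw [map_sum]
  refine Finset.sum_congr rfl fun j _ => ?_
  rw [← map_smul]; congr 1
  ext1 l
  by_cases h : l = j
  · subst h; simp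
  · simp [h]

def Gr {b b' : ℕ} (δ : Fin b → ℕ) (δ' : Fin b' → ℕ)
    (φ : (Fin b' → MvPolynomial V k) →ₗ[MvPolynomial V k] (Fin b → MvPolynomial V k)) : Prop :=
  ∀ j l, (φ (Pi.single j 1) l).IsHomogeneous (δ' j - δ l) ∧ (δ' j < δ l → φ (Pi.single j 1) l = 0)

theorem Gr.hM {b b' : ℕ} {δ : Fin b → ℕ} {δ' : Fin b' → ℕ}
    {φ : (Fin b' → MvPolynomial V k) →ₗ[MvPolynomial V k] (Fin b → MvPolynomial V k)}
    (h : Gr δ δ' φ) (l : Fin b) (j : Fin b') : (φ (Pi.single j 1) l) = 0 ∨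
      ∃ s : ℕ, (φ (Pi.single j 1) l).IsHomogeneous s ∧ (s : ℤ) = (δ' j : ℤ) - δ l := by
  by_cases hl : δ' j < δ l
  · exact Or.inl ((h j l).2 hl)
  · exact Or.inr ⟨_, (h j l).1, by omega⟩

theorem PP_lin {b b' : ℕ} (δ : Fin b → ℕ) (δ' : Fin b' → ℕ)
    (φ : (Fin b' → MvPolynomial V k) →ₗ[MvPolynomial V k] (Fin b → MvPolynomial V k))
    (h : Gr δ δ' φ) (p D : ℤ) (f : Finset V → Fin b' → MvPolynomial V k) :
    PP δ p D (fun A => φ (f A)) = fun A => φ (PP δ' p D f A) := by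
  ext1 A; ext1 l
  rw [lin_expand φ (PP δ' p D f A)]
  have := P1_sum p (D - δ l) f (fun j => φ (Pi.single j 1) l) (fun j => (δ' j : ℤ) - δ l) (h.hM l) A
  have e : (fun A => φ (f A) l) = fun A => ∑ j, f A j * φ (Pi.single j 1) l := by
    ext1 A; rw [lin_expand φ (f A)]; simp
  unfold PP
  rw [e, this, Finset.sum_apply]
  refine Finset.sum_congr rfl fun j _ => ?_
  rw [Pi.smul_apply, smul_eq_mul]
  congr 3; ring_nf

theorem const_kd {b : ℕ} (u : Finset V → Fin b → MvPolynomial V k) (A : Finset V) (j : Fin b) :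
    constantCoeff (kd (k := k) u A j) = 0 := by
  rw [kd_proj, kd_apply, map_sum]
  refine Finset.sum_eq_zero fun v _ => ?_
  rw [smul_eq_mul, map_mul, constantCoeff_X, zero_mul]

variable {I : Ideal (MvPolynomial V k)} (F : MinFreeRes k V I)

theorem const_d (i : ℕ) (x : Fin (F.b (i+1)) → MvPolynomial V k) (l : Fin (F.b i)) :
    constantCoeff (F.d i x l) = 0 := by
  rw [lin_expand (F.d i) x, Finset.sum_apply, map_sum]
  refine Finset.sum_eq_zero fun j _ => ?_
  simp [F.minimal]

theorem d_comp (i : ℕ) (x) : F.d i (F.d (i+1) x) = 0 := (F.exact_succ i).apply_apply_eq_zero x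

def ZZ : (q : ℕ) → (Finset V → Fin (F.b q) → MvPolynomial V k) → Prop
  | 0, c => ∀ A, F.aug (kd (k := k) c A) = 0
  | (q+1), c => ∃ u : Finset V → Fin (F.b q) → MvPolynomial V k, (fun A => F.d q (c A)) = kd (k := k) u

theorem ZZ_of_kd (q : ℕ) (c : Finset V → Fin (F.b q) → MvPolynomial V k)
    (h : kd (k := k) c = 0) : ZZ F q c := by
  cases q with
  | zero => intro A; rw [h]; simp
  | succ q =>
    obtain ⟨u, hu⟩ := kd_exact (fun A => F.d q (c A)) (by rw [kd_map, h]; ext; simp)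
      (fun j => const_d F q _ j)
    exact ⟨u, hu.symm⟩

theorem aug_lift : ∃ a : (Fin (F.b 0) → MvPolynomial V k) →ₗ[MvPolynomial V k] MvPolynomial V k,
    (∀ x, F.aug x = Ideal.Quotient.mk I (a x)) ∧
    ∀ (p D : ℤ) (f : Finset V → Fin (F.b 0) → MvPolynomial V k),
      P1 p D (fun A => a (f A)) = fun A => a (PP (F.deg 0) p D f A) := by
  choose m hm ha using F.aug_homog
  let a : (Fin (F.b 0) → MvPolynomial V k) →ₗ[MvPolynomial V k] MvPolynomial V k :=
    ∑ j, (LinearMap.proj (R := MvPolynomial V k) (φ := fun _ : Fin (F.b 0) => MvPolynomial V k) j).smulRight (m j)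
  have hax : ∀ x, a x = ∑ j, x j * m j := by intro x; simp [a]
  refine ⟨a, ?_, ?_⟩
  · intro x
    rw [lin_expand F.aug x, hax, map_sum]
    refine Finset.sum_congr rfl fun j _ => ?_
    rw [ha, map_mul]; rfl
  · intro p D f
    ext1 A
    simp only [hax]
    rw [P1_sum p D f m (fun j => (F.deg 0 j : ℤ)) (fun j => Or.inr ⟨_, hm j, rfl⟩)]
    rfl

theorem zigA (i D : ℤ) (hV : ∀ f : Finset V → MvPolynomial V k, P1 i D f = f →
      (∀ A, kd (k := k) f A ∈ I) → ∃ g : Finset V → MvPolynomial V k, ∀ A, f A - kd (k := k) g A ∈ I)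
    (q : ℕ) : ∀ p : ℤ, p + q = i → ∀ c : Finset V → Fin (F.b q) → MvPolynomial V k,
      PP (F.deg q) p D c = c → ZZ F q c →
      ∃ (u : Finset V → Fin (F.b q) → MvPolynomial V k)
        (v : Finset V → Fin (F.b (q+1)) → MvPolynomial V k),
        c = fun A => kd (k := k) u A + F.d q (v A) := by
  obtain ⟨a, ha, haP⟩ := aug_lift F
  induction q with
  | zero =>
    intro p hp c hc hZ
    have hp' : p = i := by simpa using hp
    subst hp'
    obtain ⟨g, hg⟩ := hV (fun A => a (c A)) (by rw [haP, hc]) (fun A => by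
      rw [kd_map, ← Ideal.Quotient.eq_zero_iff_mem, ← ha]; exact hZ A)
    have hs : ∀ A, ∃ x, F.aug x = Ideal.Quotient.mk I (g A) := fun A => F.aug_surjective _
    choose u hu using hs
    have hk : ∀ A, ∃ v, F.d 0 v = c A - kd (k := k) u A := by
      intro A
      apply (F.exact_zero _).mp
      have e1 : F.aug (kd (k := k) u A) = Ideal.Quotient.mk I (kd (k := k) g A) := by
        have h1 := congrFun (kd_map F.aug u) A
        have h2 := congrFun (kd_map (Submodule.mkQ I) g) A
        rw [← h1]
        have h3 : (fun A => F.aug (u A)) = fun A => Submodule.mkQ I (g A) := funext hu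
        rw [h3]
        exact h2
      rw [map_sub, e1, ha, ← map_sub, Ideal.Quotient.eq_zero_iff_mem]
      exact hg A
    choose v hv using hk
    exact ⟨u, v, by ext1 A; rw [hv]; abel⟩
  | succ q ih =>
    intro p hp c hc hZ
    obtain ⟨u, hu⟩ := hZ
    have hgr : Gr (F.deg q) (F.deg (q+1)) (F.d q) := F.d_homog q
    have hc1 : kd (k := k) (PP (F.deg q) (p+1) D u) = fun A => F.d q (c A) := by
      rw [← PP_kd, ← hu, PP_lin _ _ _ hgr, hc]
    set c1 := PP (F.deg q) (p+1) D u with hc1d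
    obtain ⟨u1, v1, h1⟩ := ih (p+1) (by push_cast at hp; omega) c1 (PP_idem _ _ _ _) (by
      cases q with
      | zero =>
        intro A
        rw [hc1]
        exact F.exact_zero.apply_apply_eq_zero _
      | succ q =>
        obtain ⟨w, hw⟩ := kd_exact (fun A => F.d q (c1 A)) (by
          rw [kd_map, hc1]; ext1 A; exact d_comp F q _) (fun j => const_d F q _ j)
        exact ⟨w, hw.symm⟩)
    have hk : ∀ A, ∃ v, F.d (q+1) v = c A - kd (k := k) v1 A := by
      intro A
      apply (F.exact_succ q _).mp
      have e1 := congrFun hc1 A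
      have h1' : c1 = kd (k := k) u1 + fun A => F.d q (v1 A) := h1
      rw [h1', map_add, kd_kd, zero_add, kd_map] at e1
      rw [map_sub, ← e1, sub_self]
    choose v hv using hk
    exact ⟨v1, v, by ext1 A; rw [hv]; abel⟩

theorem kd_single0 {b : ℕ} (c : Finset V → Fin b → MvPolynomial V k) (h : ∀ A, A ≠ ∅ → c A = 0) :
    kd (k := k) c = 0 := by
  ext1 A
  rw [kd_apply]
  refine Finset.sum_eq_zero fun v _ => ?_
  rw [h _ (Finset.insert_ne_empty _ _)]; simp

theorem upper (i : ℕ) (j : Fin (F.b i))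
    (hV : ∀ f : Finset V → MvPolynomial V k, P1 (i : ℤ) (F.deg i j : ℤ) f = f →
      (∀ A, kd (k := k) f A ∈ I) → ∃ g : Finset V → MvPolynomial V k, ∀ A, f A - kd (k := k) g A ∈ I) :
    False := by
  set c : Finset V → Fin (F.b i) → MvPolynomial V k := fun A => if A = ∅ then Pi.single j 1 else 0 with hcd
  have h0 : kd (k := k) c = 0 := kd_single0 c (fun A hA => by simp [hcd, hA])
  obtain ⟨u, v, h⟩ := zigA F i (F.deg i j) hV i 0 (by simp) c (by
    ext1 A; ext1 l
    unfold PP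
    rw [P1_apply]
    by_cases hA : A = ∅
    · subst hA
      simp only [hcd, if_true, Finset.card_empty, Nat.cast_zero]
      by_cases hl : l = j
      · subst hl
        simp only [Pi.single_eq_same, sub_self, sub_zero]
        exact hc_of_homog 0 _ (isHomogeneous_one _ _)
      · simp [hl]
    · rw [if_neg (by simpa using hA)]; simp [hcd, hA]) (ZZ_of_kd F i c h0)
  have h1 := congrArg constantCoeff (congrFun (congrFun h ∅) j)
  rw [Pi.add_apply, map_add, const_kd, const_d] at h1
  simp [hcd] at h1

theorem zigB (i : ℕ) (D : ℤ) (hN : ∀ j, (F.deg i j : ℤ) ≠ D)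
    (p : ℕ) : ∀ q : ℕ, p + q = i → ∀ c : Finset V → Fin (F.b q) → MvPolynomial V k,
      PP (F.deg q) p D c = c →
      (∃ c1 : Finset V → Fin (F.b (q+1)) → MvPolynomial V k, kd (k := k) c = fun A => F.d q (c1 A)) →
      ∃ (u : Finset V → Fin (F.b q) → MvPolynomial V k)
        (v : Finset V → Fin (F.b (q+1)) → MvPolynomial V k),
        c = fun A => kd (k := k) u A + F.d q (v A) := by
  induction p with
  | zero =>
    intro q hq c hc _
    obtain rfl : q = i := by omega
    obtain ⟨u, hu⟩ := kd_exact c (kd_single0 c (fun A hA => by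
        rw [← hc]; ext1 j; unfold PP; rw [P1_apply, if_neg (by simpa using hA)]; rfl)) (fun j => by
        rw [← hc]; unfold PP; rw [P1_apply, if_pos (by simp), constantCoeff_eq, coeff_hc, if_neg]
        have := hN j
        simp; omega)
    exact ⟨u, 0, by simp [hu]⟩
  | succ p ih =>
    rintro q hq c hc ⟨c0, hc0⟩
    have hgr : Gr (F.deg q) (F.deg (q+1)) (F.d q) := F.d_homog q
    have hc1 : kd (k := k) c = fun A => F.d q (PP (F.deg (q+1)) p D c0 A) := by
      rw [← PP_lin _ _ _ hgr, ← hc0, PP_kd]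
      conv_lhs => rw [← hc]
      push_cast; rfl
    set c1 := PP (F.deg (q+1)) p D c0
    have hk : ∀ A, ∃ v, F.d (q+1) v = kd (k := k) c1 A := by
      intro A
      apply (F.exact_succ q _).mp
      have := kd_kd (k := k) c
      rw [hc1, kd_map] at this
      exact congrFun this A
    choose c2 hc2 using hk
    obtain ⟨u1, v1, h1⟩ := ih (q+1) (by omega) c1 (PP_idem _ _ _ _) ⟨c2, by ext1 A; rw [hc2]⟩
    obtain ⟨u, hu⟩ := kd_exact (c - fun A => F.d q (u1 A)) (by
      rw [map_sub, kd_map, hc1]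
      ext1 A
      rw [Pi.sub_apply]
      have := congrFun h1 A
      rw [this, map_add, d_comp, add_zero, sub_self]; rfl) (fun j => by
      rw [Pi.sub_apply, Pi.sub_apply, map_sub, const_d, sub_zero, ← hc]
      unfold PP; rw [P1_apply, if_neg (by simp; omega)]; simp)
    refine ⟨u, u1, ?_⟩
    rw [hu]; ext1 A; simp

theorem lower (hI : ∀ (p D : ℤ) (w : Finset V → MvPolynomial V k), (∀ A, w A ∈ I) → ∀ A, P1 p D w A ∈ I)
    (i : ℕ) (D : ℤ) (f : Finset V → MvPolynomial V k) (hf : P1 (i : ℤ) D f = f)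
    (hcyc : ∀ A, kd (k := k) f A ∈ I)
    (hnb : ¬ ∃ g : Finset V → MvPolynomial V k, ∀ A, f A - kd (k := k) g A ∈ I) :
    ∃ j, (F.deg i j : ℤ) = D := by
  by_contra hN
  push Not at hN
  apply hnb
  obtain ⟨a, ha, haP⟩ := aug_lift F
  have hs : ∀ A, ∃ x, F.aug x = Ideal.Quotient.mk I (f A) := fun A => F.aug_surjective _
  choose c0 hc0 using hs
  have h1 : ∀ A, a (PP (F.deg 0) i D c0 A) - f A ∈ I := by
    intro A
    have h2 := hI i D (fun A => a (c0 A) - f A) (fun A => by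
      rw [← Ideal.Quotient.eq_zero_iff_mem, map_sub, ← ha, hc0, sub_self]) A
    have h3 : (fun A => a (c0 A) - f A) = (fun A => a (c0 A)) - f := rfl
    rw [h3, map_sub, haP, hf] at h2
    exact h2
  set c := PP (F.deg 0) i D c0 with hcd
  have hk : ∀ A, ∃ v, F.d 0 v = kd (k := k) c A := by
    intro A
    apply (F.exact_zero _).mp
    rw [ha, Ideal.Quotient.eq_zero_iff_mem]
    have h4 := kd_mem I (fun A => a (c A) - f A) h1 A
    have h3 : (fun A => a (c A) - f A) = (fun A => a (c A)) - f := rfl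
    rw [h3, map_sub, kd_map] at h4
    have := Ideal.add_mem _ h4 (hcyc A)
    simpa using this
  choose c1 hc1 using hk
  obtain ⟨u, v, h⟩ := zigB F i D hN i 0 (by simp) c (PP_idem _ _ _ _) ⟨c1, by ext1 A; rw [hc1]⟩
  refine ⟨fun A => a (u A), fun A => ?_⟩
  rw [kd_map]
  have h5 : a (c A) - a (kd (k := k) u A) ∈ I := by
    rw [← Ideal.Quotient.eq_zero_iff_mem, map_sub, ← ha, ← ha, congrFun h A, map_add,
      F.exact_zero.apply_apply_eq_zero]
    simp
  have := Ideal.sub_mem _ h5 (h1 A)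
  simpa using this

end PK
end Zig
section Exist

variable {k V : Type} [Field k] [Fintype V] [DecidableEq V]

namespace PK

noncomputable def PF {b : ℕ} (δ : Fin b → ℕ) (D : ℤ) (x : Fin b → MvPolynomial V k) :
    Fin b → MvPolynomial V k := fun l => hc (D - δ l) (x l)

theorem PF_idem {b : ℕ} (δ : Fin b → ℕ) (D : ℤ) (x : Fin b → MvPolynomial V k) :
    PF δ D (PF δ D x) = PF δ D x := by
  ext1 l; exact hc_idem _ _

theorem PF_lin {b b' : ℕ} (δ : Fin b → ℕ) (δ' : Fin b' → ℕ)
    (φ : (Fin b' → MvPolynomial V k) →ₗ[MvPolynomial V k] (Fin b → MvPolynomial V k))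
    (h : Gr δ δ' φ) (D : ℤ) (x : Fin b' → MvPolynomial V k) :
    PF δ D (φ x) = φ (PF δ' D x) := by
  ext1 l
  rw [lin_expand φ (PF δ' D x), lin_expand φ x]
  unfold PF
  have := hc_sum (D - δ l) x (fun j => φ (Pi.single j 1) l) (fun j => (δ' j : ℤ) - δ l) (h.hM l)
  simp only [Finset.sum_apply, Pi.smul_apply, smul_eq_mul]
  rw [this]
  refine Finset.sum_congr rfl fun j _ => ?_
  congr 3; ring

theorem PF_sum {b : ℕ} (δ : Fin b → ℕ) (x : Fin b → MvPolynomial V k) :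
    ∃ B : ℕ, x = ∑ D ∈ Finset.range B, PF δ (D : ℤ) x := by
  refine ⟨(∑ l, ((x l).totalDegree + δ l)) + 1, ?_⟩
  ext1 l
  ext d
  simp only [Finset.sum_apply, PF, coeff_sum, coeff_hc]
  by_cases h0 : coeff d (x l) = 0
  · simp [h0]
  · have h1 : d.degree ≤ (x l).totalDegree := by
      have := le_totalDegree (mem_support_iff.mpr h0)
      simpa [Finsupp.degree_apply, Finsupp.sum] using this
    have h2 : (x l).totalDegree + δ l ≤ ∑ l, ((x l).totalDegree + δ l) :=
      Finset.single_le_sum (f := fun l => (x l).totalDegree + δ l) (fun _ _ => Nat.zero_le _)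
        (Finset.mem_univ l)
    rw [Finset.sum_eq_single (d.degree + δ l)]
    · rw [if_pos]; push_cast; ring
    · intro D _ hD
      rw [if_neg]; omega
    · intro h; exfalso; apply h; rw [Finset.mem_range]; omega

structure St (k V : Type) [Field k] where
  b : ℕ
  deg : Fin b → ℕ
  N : Submodule (MvPolynomial V k) (Fin b → MvPolynomial V k)
  hom : ∀ x ∈ N, ∀ D : ℤ, PF deg D x ∈ N
  min : ∀ x ∈ N, ∀ l, constantCoeff (x l) = 0

theorem St.next (s : St k V) : ∃ (s' : St k V)
    (φ : (Fin s'.b → MvPolynomial V k) →ₗ[MvPolynomial V k] (Fin s.b → MvPolynomial V k)),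
    Gr s.deg s'.deg φ ∧ LinearMap.range φ = s.N ∧ LinearMap.ker φ = s'.N := by
  classical
  -- finite homogeneous generating sets
  let Q : Finset (Fin s.b → MvPolynomial V k) → Prop := fun t =>
    Submodule.span (MvPolynomial V k) (t : Set (Fin s.b → MvPolynomial V k)) = s.N ∧
      ∀ g ∈ t, ∃ D : ℕ, PF s.deg (D : ℤ) g = g
  have hex : ∃ t, Q t := by
    let H : Set (Fin s.b → MvPolynomial V k) := {g | g ∈ s.N ∧ ∃ D : ℕ, PF s.deg (D : ℤ) g = g}
    have hH : Submodule.span (MvPolynomial V k) H = s.N := by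
      apply le_antisymm
      · rw [Submodule.span_le]; intro g hg; exact hg.1
      · intro x hx
        obtain ⟨B, hB⟩ := PF_sum s.deg x
        rw [hB]
        exact Submodule.sum_mem _ fun D _ =>
          Submodule.subset_span ⟨s.hom x hx D, D, PF_idem _ _ _⟩
    have hfg : (Submodule.span (MvPolynomial V k) H).FG := IsNoetherian.noetherian _
    obtain ⟨t, ht, hte⟩ := (Submodule.fg_span_iff_fg_span_finset_subset H).mp hfg
    exact ⟨t, by rw [← hte, hH], fun g hg => (ht hg).2⟩
  have hmin : ∃ t, Q t ∧ ∀ t', Q t' → t.card ≤ t'.card := by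
    have hn : ∃ n, ∃ t, Q t ∧ t.card = n := by
      obtain ⟨t, ht⟩ := hex; exact ⟨_, t, ht, rfl⟩
    obtain ⟨t, ht, htn⟩ := Nat.find_spec hn
    exact ⟨t, ht, fun t' ht' => by rw [htn]; exact Nat.find_min' hn ⟨t', ht', rfl⟩⟩
  obtain ⟨t, ⟨hspan, hhom⟩, htmin⟩ := hmin
  let e : Fin t.card ≃ t := t.equivFin.symm
  have hdeg : ∀ j : Fin t.card, ∃ D : ℕ, PF s.deg (D : ℤ) (e j).1 = (e j).1 := fun j => hhom _ (e j).2
  choose dg hdg using hdeg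
  let φ : (Fin t.card → MvPolynomial V k) →ₗ[MvPolynomial V k] (Fin s.b → MvPolynomial V k) :=
    Fintype.linearCombination (MvPolynomial V k) (fun j => (e j).1)
  have hφ : ∀ j, φ (Pi.single j 1) = (e j).1 := by
    intro j; simp [φ, Fintype.linearCombination_apply_single]
  have hGr : Gr s.deg dg φ := by
    intro j l
    rw [hφ]
    have h1 : hc ((dg j : ℤ) - s.deg l) ((e j).1 l) = (e j).1 l := congrFun (hdg j) l
    by_cases hl : dg j < s.deg l
    · have h2 : (e j).1 l = 0 := by rw [← h1]; exact zero_of_hc_neg _ (by omega) _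
      rw [h2]; exact ⟨isHomogeneous_zero _ _ _, fun _ => rfl⟩
    · refine ⟨homog_of_hc _ _ ?_, fun h => absurd h hl⟩
      rw [Nat.cast_sub (by omega)]; exact h1
  have hker : ∀ x ∈ LinearMap.ker φ, ∀ D : ℤ, PF dg D x ∈ LinearMap.ker φ := by
    intro x hx D
    rw [LinearMap.mem_ker] at hx ⊢
    rw [← PF_lin _ _ _ hGr, hx]
    ext1 l; simp [PF]
  refine ⟨⟨t.card, dg, LinearMap.ker φ, hker, ?_⟩, φ, hGr, ?_, rfl⟩
  · intro x hx l
    by_contra hne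
    have h1 := hker x hx (dg l)
    set y := PF dg (dg l : ℤ) x with hy
    have hyl : y l = C (constantCoeff (x l)) := by
      rw [hy]; unfold PF; rw [sub_self]
      ext d
      rw [coeff_hc, coeff_C]
      by_cases hd : d = 0
      · subst hd; simp [constantCoeff_eq]
      · rw [if_neg, if_neg (Ne.symm hd)]
        have : d.degree ≠ 0 := by rwa [Ne, Finsupp.degree_eq_zero_iff]
        exact_mod_cast this
    -- then generator `e l` is redundant
    have hsum : ∑ j, y j • (e j).1 = 0 := by
      rw [LinearMap.mem_ker] at h1
      rw [← h1]; simp [φ, Fintype.linearCombination_apply]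
    have hmem : (e l).1 ∈ Submodule.span (MvPolynomial V k)
        ((t.erase (e l).1 : Finset _) : Set (Fin s.b → MvPolynomial V k)) := by
      rw [← Finset.add_sum_erase _ _ (Finset.mem_univ l), hyl] at hsum
      suffices hs : ∑ j ∈ Finset.univ.erase l, y j • (e j).1 ∈ Submodule.span (MvPolynomial V k)
          ((t.erase (e l).1 : Finset _) : Set (Fin s.b → MvPolynomial V k)) by
        have h4 := Submodule.smul_mem _ (C (constantCoeff (x l))⁻¹ : MvPolynomial V k)
          (Submodule.neg_mem _ hs)
        rwa [← eq_neg_of_add_eq_zero_left hsum, smul_smul, ← C_mul, inv_mul_cancel₀ hne, C_1,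
          one_smul] at h4
      refine Submodule.sum_mem _ fun j hj => ?_
      refine Submodule.smul_mem _ _ (Submodule.subset_span ?_)
      rw [Finset.mem_coe, Finset.mem_erase]
      refine ⟨fun h => (Finset.mem_erase.mp hj).1 (e.injective (Subtype.ext h)), (e j).2⟩
    have hQ : Q (t.erase (e l).1) := by
      refine ⟨?_, fun g hg => hhom g (Finset.mem_of_mem_erase hg)⟩
      rw [← hspan]
      apply le_antisymm
      · exact Submodule.span_mono (by intro g hg; exact Finset.mem_of_mem_erase hg)
      · rw [Submodule.span_le]
        intro g hg
        by_cases hge : g = (e l).1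
        · rw [hge]; exact hmem
        · exact Submodule.subset_span (Finset.mem_coe.mpr (Finset.mem_erase.mpr ⟨hge, hg⟩))
    have := htmin _ hQ
    rw [Finset.card_erase_of_mem (e l).2] at this
    have : 0 < t.card := Finset.card_pos.mpr ⟨_, (e l).2⟩
    omega
  · rw [Fintype.range_linearCombination, ← hspan]
    congr 1
    ext g
    simp only [Set.mem_range, Finset.mem_coe]
    constructor
    · rintro ⟨j, rfl⟩; exact (e j).2
    · intro hg; exact ⟨e.symm ⟨g, hg⟩, by simp⟩

noncomputable def St.nx (s : St k V) : St k V := s.next.choose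

noncomputable def St.seq (s : St k V) : ℕ → St k V
  | 0 => s
  | (n+1) => (St.seq s n).nx

theorem exists_res (I : Ideal (MvPolynomial V k))
    (hhom : ∀ x ∈ I, ∀ D : ℤ, hc D x ∈ I) (hmin : ∀ x ∈ I, constantCoeff x = 0) :
    Nonempty (MinFreeRes k V I) := by
  let pr : (Fin 1 → MvPolynomial V k) →ₗ[MvPolynomial V k] MvPolynomial V k := LinearMap.proj 0
  let s : St k V :=
    { b := 1
      deg := fun _ => 0
      N := Submodule.comap pr I
      hom := by
        intro x hx D
        have : hc D (x 0) ∈ I := hhom _ hx D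
        simpa [pr, PF] using this
      min := by
        intro x hx l
        obtain rfl : l = 0 := Subsingleton.elim _ _
        exact hmin _ hx }
  have hd : ∀ n, ∃ φ : (Fin (s.seq (n+1)).b → MvPolynomial V k) →ₗ[MvPolynomial V k]
      (Fin (s.seq n).b → MvPolynomial V k), Gr (s.seq n).deg (s.seq (n+1)).deg φ ∧
      LinearMap.range φ = (s.seq n).N ∧ LinearMap.ker φ = (s.seq (n+1)).N :=
    fun n => (s.seq n).next.choose_spec
  choose d hG hr hk using hd
  refine ⟨{ b := fun n => (s.seq n).b
            deg := fun n => (s.seq n).deg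
            d := d
            aug := (Submodule.mkQ I).comp pr
            aug_surjective := ?_
            exact_zero := ?_
            exact_succ := ?_
            aug_homog := ?_
            d_homog := hG
            minimal := ?_ }⟩
  · intro y
    obtain ⟨x, rfl⟩ := Submodule.mkQ_surjective I y
    exact ⟨fun _ => x, rfl⟩
  · intro x
    have h1 : x ∈ Set.range (d 0) ↔ x ∈ (s.seq 0).N := by rw [← hr 0]; rfl
    rw [h1]
    exact Ideal.Quotient.eq_zero_iff_mem
  · intro i
    rw [LinearMap.exact_iff, hr, hk]
  · intro j
    refine ⟨1, isHomogeneous_one _ _, ?_⟩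
    obtain rfl : j = (0 : Fin 1) := Subsingleton.elim (α := Fin 1) _ _
    simp [pr]; rfl
  · intro i j l
    apply (s.seq i).min
    rw [← hr i]
    exact ⟨_, rfl⟩

end PK
end Exist
section LowerChain

variable {k V : Type} [Field k] [Fintype V] [DecidableEq V]

namespace PK

theorem P1_ep (p D : ℤ) (v : V) (f : Finset V → MvPolynomial V k) (hf : P1 p D f = f) :
    P1 (p + 1) (D + 1) (ep (k := k) v f) = ep (k := k) v f := by
  ext1 A
  rw [P1_apply, ep_apply]
  by_cases hv : v ∈ A
  · have hcard := Finset.card_erase_add_one hv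
    have h1 := congrFun hf (A.erase v)
    rw [P1_apply] at h1
    rw [if_pos hv]
    by_cases hp : ((A.erase v).card : ℤ) = p
    · rw [if_pos hp] at h1
      rw [if_pos (by omega), map_zsmul]
      conv_rhs => rw [← h1]
      congr 3; ring
    · rw [if_neg hp] at h1
      rw [if_neg (by omega), ← h1, smul_zero]
  · simp [hv]

theorem nzd_MI (S : Set (Finset V)) (P : Finset V) (hP : ∀ s ∈ S, Disjoint s P)
    (f : MvPolynomial V k) (h : (∏ v ∈ P, X v) * f ∈ MI k S) : f ∈ MI k S := by
  induction P using Finset.induction_on generalizing f with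
  | empty => simpa using h
  | insert y P hy ih =>
    have hy' : ∀ s ∈ S, y ∉ s := fun s hs => by
      have := hP s hs
      rw [Finset.disjoint_insert_right] at this
      exact this.1
    apply ih (fun s hs => by
      have := hP s hs
      rw [Finset.disjoint_insert_right] at this
      exact this.2)
    rw [Finset.prod_insert hy, mul_assoc, mul_mem_MI] at h
    refine MI_congr _ _ ?_ h
    rintro _ ⟨s, hs, rfl⟩
    exact ⟨s, hs, by simp [Finset.erase_eq_of_notMem (hy' s hs)]⟩

def JU (O : Set V) (n : V → Finset V) (z : V → V) (U : Finset V) : Set (Finset V) :=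
  {s | (∃ u ∈ O, s = {u}) ∨ ∃ w ∈ U, s = insert (z w) (n w)}

theorem chain (O : Set V) (n : V → Finset V) (z : V → V) (B : Finset V)
    (hO : ∀ u ∈ O, ∀ w ∈ B, u ∉ insert (z w) (n w)) (hz : ∀ w ∈ B, z w ∉ n w)
    (hdis : ∀ w ∈ B, ∀ w' ∈ B, w ≠ w' → Disjoint (insert (z w) (n w)) (insert (z w') (n w')))
    (U : Finset V) : U ⊆ B → ∃ e : Finset V → MvPolynomial V k,
      P1 (U.card : ℤ) (U.card : ℤ) e = e ∧
      (∀ A, kd (k := k) e A ∈ Ideal.span ((fun w => (X (z w) : MvPolynomial V k)) '' (U : Set V))) ∧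
      (∀ A, kd (k := k) ((∏ w ∈ U, ∏ v ∈ n w, (X v : MvPolynomial V k)) • e) A ∈ MI k (JU O n z U)) ∧
      ¬ ∃ g : Finset V → MvPolynomial V k, ∀ A,
        ((∏ w ∈ U, ∏ v ∈ n w, (X v : MvPolynomial V k)) • e) A - kd (k := k) g A ∈ MI k (JU O n z U) := by
  induction U using Finset.induction_on with
  | empty =>
    intro _
    have h0 : kd (k := k) (fun A : Finset V => if A = ∅ then (1 : MvPolynomial V k) else 0) = 0 := by
      ext1 A
      rw [kd_apply]
      refine Finset.sum_eq_zero fun v _ => ?_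
      simp
    refine ⟨fun A => if A = ∅ then 1 else 0, ?_, ?_, ?_, ?_⟩
    · ext1 A
      rw [P1_apply]
      by_cases hA : A = ∅
      · subst hA
        simp only [Finset.card_empty, Nat.cast_zero, if_true, sub_zero]
        exact hc_of_homog 0 _ (isHomogeneous_one _ _)
      · simp [hA]
    · intro A; rw [h0]; simp
    · intro A; rw [Finset.prod_empty, one_smul, h0]; exact Ideal.zero_mem _
    · rintro ⟨g, hg⟩
      have h1 := hg ∅
      rw [Finset.prod_empty, one_smul, mem_MI] at h1
      have h2 : (0 : V →₀ ℕ) ∈ ((if (∅ : Finset V) = ∅ then (1 : MvPolynomial V k) else 0) -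
          kd (k := k) g ∅).support := by
        rw [mem_support_iff, ← constantCoeff_eq, map_sub, kd_apply, map_sum,
          Finset.sum_eq_zero]
        · simp
        · intro v _; rw [smul_eq_mul, map_mul, constantCoeff_X, zero_mul]
      obtain ⟨s, hs, hs2⟩ := h1 0 h2
      rcases hs with ⟨u, _, rfl⟩ | ⟨w, hw, _⟩
      · simp at hs2
      · simp at hw
  | insert w U hw ih =>
    intro hUB
    have hwB : w ∈ B := hUB (Finset.mem_insert_self _ _)
    have hUB' : U ⊆ B := fun x hx => hUB (Finset.mem_insert_of_mem hx)
    obtain ⟨e, he1, he2, he3, he4⟩ := ih hUB'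
    set NU := ∏ w ∈ U, ∏ v ∈ n w, (X v : MvPolynomial V k)
    set nw := ∏ v ∈ n w, (X v : MvPolynomial V k) with hnw
    have hsub : MI k (JU O n z U) ≤ MI k (JU O n z (insert w U)) := by
      apply MI_congr
      rintro s (h | ⟨u, hu, h⟩)
      · exact ⟨s, Or.inl h, subset_rfl⟩
      · exact ⟨s, Or.inr ⟨u, Finset.mem_insert_of_mem hu, h⟩, subset_rfl⟩
    have hq : nw * X (z w) = ∏ v ∈ insert (z w) (n w), (X v : MvPolynomial V k) := by
      rw [Finset.prod_insert (hz w hwB), mul_comm]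
    have hqm : nw * X (z w) ∈ MI k (JU O n z (insert w U)) := by
      rw [hq]
      exact prod_mem_MI _ _ _ (Or.inr ⟨w, Finset.mem_insert_self _ _, rfl⟩) subset_rfl
    have hkd : kd (k := k) ((nw * NU) • ep (k := k) (z w) e) =
        (nw * X (z w)) • (NU • e) - nw • ep (k := k) (z w) (kd (k := k) (NU • e)) := by
      simp only [map_smul]
      rw [kd_ep]
      ext1 A
      simp only [Pi.smul_apply, Pi.sub_apply, smul_eq_mul]
      ring
    rw [Finset.prod_insert hw]
    refine ⟨ep (k := k) (z w) e, ?_, ?_, ?_, ?_⟩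
    · rw [Finset.card_insert_of_notMem hw]
      push_cast
      exact P1_ep _ _ _ _ he1
    · intro A
      rw [kd_ep]
      refine Ideal.sub_mem _ ?_ ?_
      · rw [Pi.smul_apply, smul_eq_mul]
        exact Ideal.mul_mem_right _ _ (Ideal.subset_span ⟨w, by simp, rfl⟩)
      · exact Ideal.span_mono (Set.image_mono (by simp)) (ep_mem (Ideal.span _) _ _ he2 A)
    · intro A
      rw [hkd]
      refine Ideal.sub_mem _ ?_ ?_
      · rw [Pi.smul_apply, smul_eq_mul]
        exact Ideal.mul_mem_right _ _ hqm
      · rw [Pi.smul_apply, smul_eq_mul]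
        exact Ideal.mul_mem_left _ _ (hsub (ep_mem (MI k (JU O n z U)) _ _ he3 A))
    · rintro ⟨g, hg⟩
      apply he4
      have hdec : ∀ x : MvPolynomial V k, x ∈ MI k (JU O n z (insert w U)) →
          ∃ u y, y ∈ MI k (JU O n z U) ∧ x = (nw * X (z w)) * u + y := by
        intro x hx
        have hset : JU O n z (insert w U) = insert (insert (z w) (n w)) (JU O n z U) := by
          ext s
          simp only [JU, Set.mem_insert_iff, Set.mem_ofPred_eq, Finset.mem_insert]
          constructor
          · rintro (h | ⟨x, rfl | hx, rfl⟩)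
            · exact Or.inr (Or.inl h)
            · exact Or.inl rfl
            · exact Or.inr (Or.inr ⟨x, hx, rfl⟩)
          · rintro (rfl | h | ⟨x, hx, rfl⟩)
            · exact Or.inr ⟨w, Or.inl rfl, rfl⟩
            · exact Or.inl h
            · exact Or.inr ⟨x, Or.inr hx, rfl⟩
        rw [hset, MI, Set.image_insert_eq, Ideal.mem_span_insert] at hx
        obtain ⟨a, y, hy, rfl⟩ := hx
        exact ⟨a, y, hy, by rw [hq]; ring⟩
      choose u y hy hxe using fun A => hdec _ (hg A)
      refine ⟨u, fun A => ?_⟩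
      have e0 : (nw * NU) • ep (k := k) (z w) e = kd (k := k) g + (nw * X (z w)) • u + y := by
        ext1 A
        have := hxe A
        simp only [Pi.add_apply, Pi.smul_apply, smul_eq_mul] at this ⊢
        linear_combination this
      have e1 := congrArg (kd (k := k)) e0
      have hs : kd (k := k) ((nw * X (z w)) • u) = (nw * X (z w)) • kd (k := k) u := map_smul _ _ _
      rw [hkd, map_add, map_add, kd_kd, hs, zero_add] at e1
      have e2 := congrFun e1 A
      simp only [Pi.add_apply, Pi.sub_apply, Pi.smul_apply, smul_eq_mul] at e2
      apply nzd_MI _ (insert (z w) (n w))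
      · rintro s (⟨o, ho, rfl⟩ | ⟨w', hw', rfl⟩)
        · rw [Finset.disjoint_singleton_left]; exact hO o ho w hwB
        · exact hdis _ (hUB' hw') _ hwB (by rintro rfl; exact hw hw')
      · rw [← hq]
        have e3 : nw * X (z w) * ((NU • e) A - kd (k := k) u A) =
            nw * ep (k := k) (z w) (kd (k := k) (NU • e)) A + kd (k := k) y A := by
          simp only [Pi.smul_apply, smul_eq_mul]
          linear_combination e2
        rw [e3]
        exact Ideal.add_mem _ (Ideal.mul_mem_left _ _ (ep_mem (MI k (JU O n z U)) _ _ he3 A))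
          (kd_mem (MI k (JU O n z U)) _ hy A)

end PK
end LowerChain
section TreeComb

variable {V : Type} [Fintype V] [DecidableEq V]

namespace PK

theorem level_root (T : RTree V) : T.level T.root = 0 := by
  rw [RTree.level, Nat.find_eq_zero]; rfl

theorem level_zero (T : RTree V) (v : V) (h : T.level v = 0) : v = T.root := by
  rw [RTree.level, Nat.find_eq_zero] at h; exact h

theorem level_parent (T : RTree V) (v : V) (h : v ≠ T.root) :
    T.level v = T.level (T.parent v) + 1 := by
  apply le_antisymm
  · rw [RTree.level]
    apply Nat.find_min'
    rw [Function.iterate_succ_apply]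
    exact Nat.find_spec (T.reach (T.parent v))
  · have h0 : T.level v ≠ 0 := fun e => h (level_zero T v e)
    obtain ⟨n, hn⟩ := Nat.exists_eq_succ_of_ne_zero h0
    rw [hn]
    apply Nat.succ_le_succ
    rw [RTree.level]
    apply Nat.find_min'
    have := Nat.find_spec (T.reach v)
    change T.parent^[T.level v] v = T.root at this
    rw [hn, Function.iterate_succ_apply] at this
    exact this

theorem level_iter (T : RTree V) (j : ℕ) : ∀ v : V, j ≤ T.level v →
    T.level (T.parent^[j] v) + j = T.level v := by
  induction j with
  | zero => intro v _; rfl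
  | succ j ih =>
    intro v h
    have hv : v ≠ T.root := by rintro rfl; rw [level_root] at h; omega
    have := level_parent T v hv
    have h2 := ih (T.parent v) (by omega)
    rw [Function.iterate_succ_apply]; omega

theorem level_le (T : RTree V) (v : V) : T.level v ≤ T.height :=
  Finset.le_sup (f := fun v => T.level v) (Finset.mem_univ v)

theorem exists_child (T : RTree V) (hp : T.Perfect) (v : V) (h : T.level v < T.height) :
    ∃ y, T.parent y = v ∧ y ≠ T.root := by
  by_contra hc
  push Not at hc
  have := hp v hc
  omega

theorem exists_desc (T : RTree V) (hp : T.Perfect) (m : ℕ) : ∀ v : V, T.level v + m ≤ T.height →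
    ∃ w, T.parent^[m] w = v ∧ T.level w = T.level v + m := by
  induction m with
  | zero => intro v _; exact ⟨v, rfl, rfl⟩
  | succ m ih =>
    intro v h
    obtain ⟨y, hy, hr⟩ := exists_child T hp v (by omega)
    have hl := level_parent T y hr
    rw [hy] at hl
    obtain ⟨w, hw, hw2⟩ := ih y (by omega)
    refine ⟨w, ?_, by omega⟩
    rw [Function.iterate_succ_apply', hw, hy]

/-- vertices of the path on `height` vertices ending at `v` -/
noncomputable def pset (T : RTree V) (v : V) : Finset V :=
  (Finset.range T.height).image (fun j => T.parent^[j] v)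

theorem mem_pset (T : RTree V) (v u : V) : u ∈ pset T v ↔ ∃ j < T.height, T.parent^[j] v = u := by
  simp [pset]

theorem prod_pset {k : Type} [Field k] (T : RTree V) (v : V) (h : T.height ≤ T.level v + 1) :
    T.pathMonomial k T.height v = ∏ u ∈ pset T v, X u := by
  rw [pset, Finset.prod_image]
  · rfl
  · intro a ha b hb e
    simp only [Finset.coe_range, Set.mem_Iio] at ha hb
    have h1 := level_iter T a v (by omega)
    have h2 := level_iter T b v (by omega)
    simp only at e
    rw [e] at h1
    omega

def PS (T : RTree V) : Set (Finset V) := {s | ∃ v, T.height ≤ T.level v + 1 ∧ s = pset T v}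

noncomputable def WW (T : RTree V) : Finset V :=
  Finset.univ.filter fun v => 1 ≤ T.level v ∧ T.level v + 1 ≤ T.height

noncomputable def BB (T : RTree V) : Finset V :=
  Finset.univ.filter fun v => 1 ≤ T.level v ∧ T.level v + 1 = T.height

theorem mem_WW (T : RTree V) (v : V) : v ∈ WW T ↔ 1 ≤ T.level v ∧ T.level v + 1 ≤ T.height := by
  simp [WW]

theorem mem_BB (T : RTree V) (v : V) : v ∈ BB T ↔ 1 ≤ T.level v ∧ T.level v + 1 = T.height := by
  simp [BB]

theorem PS_card (T : RTree V) : ∀ s ∈ PS T, (s \ WW T).card ≤ 1 := by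
  rintro s ⟨v, hv, rfl⟩
  rw [Finset.card_le_one]
  intro a ha b hb
  simp only [Finset.mem_sdiff, mem_pset, mem_WW] at ha hb
  obtain ⟨⟨i, hi, rfl⟩, ha⟩ := ha
  obtain ⟨⟨j, hj, rfl⟩, hb⟩ := hb
  have h1 := level_iter T i v (by omega)
  have h2 := level_iter T j v (by omega)
  have h3 := level_le T v
  have : i = j := by omega
  rw [this]

theorem sum_eq (T : RTree V) :
    ∑ x : V, (if T.level x + 2 ≤ T.height then (T.outdeg x : ℤ) else 0) = ((WW T).card : ℤ) := by
  rw [Finset.card_eq_sum_card_fiberwise (f := T.parent) (t := Finset.univ) (fun _ _ => by simp)]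
  push_cast
  refine Finset.sum_congr rfl fun x _ => ?_
  have key : ∀ y : V, T.parent y = x → y ≠ T.root → T.level y = T.level x + 1 := by
    rintro y rfl hr; exact level_parent T y hr
  split_ifs with h
  · rw [RTree.outdeg, Nat.card_eq_fintype_card, Fintype.card_subtype]
    congr 2
    ext y
    simp only [Finset.mem_filter, Finset.mem_univ, true_and, mem_WW]
    constructor
    · rintro ⟨h1, h2⟩
      have := key y h1 h2
      exact ⟨by omega, h1⟩
    · rintro ⟨⟨h1, h2⟩, h3⟩
      refine ⟨h3, ?_⟩
      rintro rfl
      rw [level_root] at h1; omega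
  · symm
    rw [Nat.cast_eq_zero, Finset.card_eq_zero, Finset.filter_eq_empty_iff]
    intro y hy e
    rw [mem_WW] at hy
    have := key y e (by rintro rfl; rw [level_root] at hy; omega)
    omega

end PK
end TreeComb
section Final

variable {k V : Type} [Field k] [Fintype V] [DecidableEq V]

namespace PK

theorem pathIdeal_eq (T : RTree V) : T.pathIdeal k T.height = MI k (PS T) := by
  rw [RTree.pathIdeal, MI]
  congr 1
  ext m
  constructor
  · rintro ⟨v, hv, rfl⟩
    exact ⟨pset T v, ⟨v, hv, rfl⟩, (prod_pset T v hv).symm⟩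
  · rintro ⟨s, ⟨v, hv, rfl⟩, rfl⟩
    exact ⟨v, hv, (prod_pset T v hv).symm⟩

theorem hc_mem_MI (S : Set (Finset V)) (x : MvPolynomial V k) (hx : x ∈ MI k S) (D : ℤ) :
    hc D x ∈ MI k S := by
  rw [mem_MI] at hx ⊢
  intro ξ hξ
  apply hx
  rw [mem_support_iff, coeff_hc] at hξ
  rw [mem_support_iff]
  intro h
  apply hξ
  simp [h]

theorem const_MI (S : Set (Finset V)) (hS : ∅ ∉ S) (x : MvPolynomial V k) (hx : x ∈ MI k S) :
    constantCoeff x = 0 := by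
  rw [mem_MI] at hx
  by_contra h
  obtain ⟨s, hs, h1⟩ := hx 0 (by rw [mem_support_iff]; exact h)
  have : s = ∅ := by simpa using h1
  exact hS (this ▸ hs)

theorem cycle_exists (T : RTree V) (hh : 1 ≤ T.height) (hp : T.Perfect) :
    ∃ c : Finset V → MvPolynomial V k,
      P1 ((BB T).card : ℤ) ((BB T).card + (WW T).card : ℤ) c = c ∧
      (∀ A, kd (k := k) c A ∈ MI k (PS T)) ∧
      ¬ ∃ g : Finset V → MvPolynomial V k, ∀ A, c A - kd (k := k) g A ∈ MI k (PS T) := by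
  classical
  -- choice of a descendant on level `h - 1`
  have hf : ∀ v : V, ∃ w, v ∈ WW T → w ∈ BB T ∧ ∃ m, T.parent^[m] w = v := by
    intro v
    by_cases hv : v ∈ WW T
    · rw [mem_WW] at hv
      obtain ⟨w, hw, hl⟩ := exists_desc T hp (T.height - 1 - T.level v) v (by omega)
      exact ⟨w, fun _ => ⟨by rw [mem_BB]; omega, _, hw⟩⟩
    · exact ⟨v, fun h => absurd h hv⟩
  choose f hf using hf
  have hzz : ∀ w : V, ∃ y, w ∈ BB T → T.parent y = w ∧ y ≠ T.root := by
    intro w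
    by_cases hw : w ∈ BB T
    · have hw2 := (mem_BB T w).1 hw
      obtain ⟨y, hy⟩ := exists_child T hp w (by omega)
      exact ⟨y, fun _ => hy⟩
    · exact ⟨w, fun h => absurd h hw⟩
  choose z hzz using hzz
  have hzl : ∀ w ∈ BB T, T.level (z w) = T.height := by
    intro w hw
    have h1 := level_parent T (z w) (hzz w hw).2
    rw [(hzz w hw).1] at h1
    have := (mem_BB T w).1 hw
    omega
  set n : V → Finset V := fun w => (WW T).filter (fun v => f v = w) with hn
  have hnm : ∀ w v, v ∈ n w ↔ v ∈ WW T ∧ f v = w := by intro w v; simp [hn]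
  set O : Set V := {u | u ∉ WW T ∧ ∀ w ∈ BB T, u ≠ z w} with hOd
  have hzW : ∀ w ∈ BB T, z w ∉ WW T := by
    intro w hw h
    have h1 := hzl w hw
    rw [mem_WW] at h
    omega
  obtain ⟨e, he1, he2, -, he4⟩ := chain (k := k) O n z (BB T)
    (by
      rintro u ⟨hu1, hu2⟩ w hw h
      rw [Finset.mem_insert, hnm] at h
      rcases h with h | h
      · exact hu2 w hw h
      · exact hu1 h.1)
    (by
      intro w hw h
      rw [hnm] at h
      exact hzW w hw h.1)
    (by
      intro w hw w' hw' hne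
      rw [Finset.disjoint_left]
      intro u hu hu'
      rw [Finset.mem_insert, hnm] at hu hu'
      rcases hu with rfl | hu
      · rcases hu' with hu' | hu'
        · apply hne
          rw [← (hzz w hw).1, hu', (hzz w' hw').1]
        · exact hzW w hw hu'.1
      · rcases hu' with rfl | hu'
        · exact hzW w' hw' hu.1
        · exact hne (hu.2.symm.trans hu'.2))
    (BB T) (Finset.Subset.refl _)
  have hN : (∏ w ∈ BB T, ∏ v ∈ n w, (X v : MvPolynomial V k)) = ∏ v ∈ WW T, X v :=
    Finset.prod_fiberwise_of_maps_to (fun v hv => (hf v hv).1) _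
  rw [hN] at he4
  refine ⟨(∏ v ∈ WW T, (X v : MvPolynomial V k)) • e, ?_, ?_, fun ⟨g, hg⟩ => he4 ⟨g, fun A => ?_⟩⟩
  · have hom : (∏ v ∈ WW T, (X v : MvPolynomial V k)).IsHomogeneous (WW T).card := by
      have := IsHomogeneous.prod (WW T) (fun v => (X v : MvPolynomial V k)) (fun _ => 1)
        (fun v _ => isHomogeneous_X k v)
      simpa using this
    have h1 := P1_mul ((BB T).card : ℤ) ((BB T).card : ℤ) _ _ hom e
    rw [he1] at h1
    have h2 : (∏ v ∈ WW T, (X v : MvPolynomial V k)) • e =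
        fun A => e A * ∏ v ∈ WW T, (X v : MvPolynomial V k) := by
      ext1 A
      simp only [Pi.smul_apply, smul_eq_mul]
      ring
    rw [h2]
    exact h1
  · intro A
    rw [map_smul, Pi.smul_apply, smul_eq_mul]
    have hA := he2 A
    refine Submodule.span_induction (p := fun x _ => (∏ v ∈ WW T, (X v : MvPolynomial V k)) * x ∈
      MI k (PS T)) ?_ ?_ ?_ ?_ hA
    · rintro _ ⟨w, hw, rfl⟩
      have hw : w ∈ BB T := hw
      have hl := hzl w hw
      have h3 : (∏ v ∈ WW T, (X v : MvPolynomial V k)) * X (z w) = ∏ v ∈ insert (z w) (WW T), X v := by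
        rw [Finset.prod_insert (hzW w hw), mul_comm]
      change (∏ v ∈ WW T, (X v : MvPolynomial V k)) * X (z w) ∈ MI k (PS T)
      rw [h3]
      refine prod_mem_MI (PS T) (pset T (z w)) _ ⟨z w, by omega, rfl⟩ ?_
      intro u hu
      rw [mem_pset] at hu
      obtain ⟨j, hj, rfl⟩ := hu
      have h1 := level_iter T j (z w) (by omega)
      rw [Finset.mem_insert]
      rcases Nat.eq_zero_or_pos j with rfl | h0
      · left; rfl
      · right; rw [mem_WW]; omega
    · simp
    · intro x y _ _ hx hy
      rw [mul_add]; exact Ideal.add_mem _ hx hy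
    · intro a x _ hx
      rw [smul_eq_mul, mul_left_comm]; exact Ideal.mul_mem_left _ _ hx
  · refine MI_congr (PS T) (JU O n z (BB T)) ?_ (hg A)
    rintro s ⟨v, hv, rfl⟩
    have hl := level_le T v
    rcases Nat.lt_or_ge (T.level v) T.height with h1 | h1
    · refine ⟨{T.root}, Or.inl ⟨T.root, ⟨?_, ?_⟩, rfl⟩, ?_⟩
      · rw [mem_WW, level_root]; omega
      · intro w hw; exact (hzz w hw).2.symm
      · rw [Finset.singleton_subset_iff, mem_pset]
        exact ⟨T.level v, h1, level_zero T _ (by have := level_iter T _ v le_rfl; omega)⟩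
    · by_cases hvz : ∃ w ∈ BB T, v = z w
      · obtain ⟨w, hw, rfl⟩ := hvz
        refine ⟨_, Or.inr ⟨w, hw, rfl⟩, ?_⟩
        intro u hu
        rw [mem_pset]
        rw [Finset.mem_insert, hnm] at hu
        rcases hu with rfl | ⟨hu, rfl⟩
        · exact ⟨0, by omega, rfl⟩
        · obtain ⟨hb, m, hm⟩ := hf u hu
          have hbl := (mem_BB T _).1 hb
          have hul := (mem_WW T _).1 hu
          refine ⟨m + 1, ?_, ?_⟩
          · by_contra hlt
            have h5 : T.parent^[m] (f u) = T.root := by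
              obtain ⟨q, rfl⟩ := Nat.exists_eq_add_of_le (show T.level (f u) ≤ m by omega)
              rw [add_comm, Function.iterate_add_apply]
              have : T.parent^[T.level (f u)] (f u) = T.root :=
                level_zero T _ (by have := level_iter T _ (f u) le_rfl; omega)
              rw [this]
              exact Function.iterate_fixed T.parent_root q
            rw [hm] at h5
            rw [h5, level_root] at hul
            omega
          · rw [Function.iterate_succ_apply, (hzz _ hb).1, hm]
      · push Not at hvz
        refine ⟨{v}, Or.inl ⟨v, ⟨?_, hvz⟩, rfl⟩, ?_⟩
        · rw [mem_WW]; omega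
        · rw [Finset.singleton_subset_iff, mem_pset]
          exact ⟨0, by omega, rfl⟩

end PK
end Final

/-- Theorem 3.2: for a perfect rooted tree of height `h ≥ 1` and `t = h`,
`reg(R/I_t(Γ)) = Σ_{0 ≤ ℓ(x) ≤ h-2} deg⁺(x)`. -/
theorem reg_path_ideal_perfect_height
    {k V : Type} [Field k] [Fintype V] [DecidableEq V] (T : RTree V)
    (hh : 1 ≤ T.height) (hperf : T.Perfect) :
    reg k V (T.pathIdeal k T.height) =
      ∑ x : V, (if T.level x + 2 ≤ T.height then (T.outdeg x : ℤ) else 0) := by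
  rw [PK.sum_eq, PK.pathIdeal_eq, reg]
  apply IsGreatest.csSup_eq
  constructor
  · have hne : ∅ ∉ PK.PS T := by
      rintro ⟨v, hv, h⟩
      have : v ∈ PK.pset T v := (PK.mem_pset T v v).2 ⟨0, by omega, rfl⟩
      rw [← h] at this
      simp at this
    obtain ⟨F⟩ := PK.exists_res (PK.MI k (PK.PS T)) (fun x hx D => PK.hc_mem_MI _ x hx D)
      (PK.const_MI _ hne)
    obtain ⟨c, h1, h2, h3⟩ := PK.cycle_exists (k := k) T hh hperf
    obtain ⟨j, hj⟩ := PK.lower F (fun p D w hw A => PK.P1_mem_MI _ p D w hw A) _ _ c h1 h2 h3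
    exact ⟨F, _, j, by rw [hj]; ring⟩
  · rintro _ ⟨F, i, j, rfl⟩
    by_contra hlt
    exact PK.upper F i j (fun f hf hcyc =>
      PK.Van_main (k := k) (PK.WW T) (PK.PS T) (PK.PS_card T) i (F.deg i j) (by omega) f hf hcyc)
end
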